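/- arXiv:2203.00406 — 2 statements merged into one kernel-verified Lean document; each statement's English description precedes it below -/
import Mathlib

section
/- Let R = (a^b) with a ≥ 1 and 1 ≤ b ≤ n, let T ∈ CSST_[n](R) have symmetrized offset vector η = (η₁,…,η_{a−1}), and let α = (α₁,…,α_a) ∈ ℤ^a. Then τ_n^{α_rev}(T) ∈ B_n(R), where α_rev = (α_a, α_{a−1}, …, α₁), if and only if α_a ≤ α_{a−1} − η_{a−1} ≤ α_{a−2} − η_{a−2} ≤ ⋯ ≤ α₁ − η₁. -/
open scoped Classical

namespace AffineRSK

/-- `ℤ × ℤ`-matrices with non-negative integer entries. -/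
abbrev Mat : Type := ℤ → ℤ → ℕ

abbrev Cell : Type := ℤ × ℤ

/-- Generalized affine permutations of period `(m, n)`:
`a_{i+m, j+n} = a_{ij}` and each column has finite support. -/
def IsGAP (m n : ℕ) (A : Mat) : Prop :=
  (∀ i j : ℤ, A (i + m) (j + n) = A i j) ∧ ∀ j : ℤ, {i : ℤ | A i j ≠ 0}.Finite

/-- Generalized dual affine permutations: entries in `{0, 1}`. -/
def IsGDAP (m n : ℕ) (A : Mat) : Prop :=
  IsGAP m n A ∧ ∀ i j : ℤ, A i j ≤ 1

def supp (A : Mat) : Set Cell := {c : Cell | A c.1 c.2 ≠ 0}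

def tauC (m n : ℕ) (c : Cell) : Cell := (c.1 + (m : ℤ), c.2 + (n : ℤ))

/-- `NW c₁ c₂` means `c₁ >_NW c₂`. -/
def NW (c₁ c₂ : Cell) : Prop := c₁.1 < c₂.1 ∧ c₁.2 < c₂.2

/-- `nwGe c₁ c₂` means `c₁ ≥_nw c₂`. -/
def nwGe (c₁ c₂ : Cell) : Prop := c₁.1 ≤ c₂.1 ∧ c₁.2 ≤ c₂.2

/-- `neLe c₁ c₂` means `c₁ ≤_ne c₂`. -/
def neLe (c₁ c₂ : Cell) : Prop := c₂.1 ≤ c₁.1 ∧ c₁.2 ≤ c₂.2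

/-- `nWgt c₁ c₂` means `c₁ >_nW c₂` (dual order). -/
def nWgt (c₁ c₂ : Cell) : Prop := c₁.1 ≤ c₂.1 ∧ c₁.2 < c₂.2

/-- `NeLt c₁ c₂` means `c₁ <_Ne c₂` (dual order). -/
def NeLt (c₁ c₂ : Cell) : Prop := c₂.1 < c₁.1 ∧ c₁.2 ≤ c₂.2

/-- A proper numbering on `A`. -/
def IsProper (A : Mat) (d : Cell → ℤ) : Prop :=
  (∀ c₁ ∈ supp A, ∀ c₂ ∈ supp A, NW c₂ c₁ → d c₂ < d c₁) ∧
    ∀ c₁ ∈ supp A, ∃ c₂ ∈ supp A, NW c₂ c₁ ∧ d c₂ = d c₁ - 1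

/-- A dual proper numbering on `A`. -/
def IsProper' (A : Mat) (d : Cell → ℤ) : Prop :=
  (∀ c₁ ∈ supp A, ∀ c₂ ∈ supp A, nWgt c₂ c₁ → d c₂ < d c₁) ∧
    ∀ c₁ ∈ supp A, ∃ c₂ ∈ supp A, nWgt c₂ c₁ ∧ d c₂ = d c₁ - 1

/-- An enumeration of a stream of flow `l`. -/
def IsStreamEnum (m n : ℕ) (e : ℤ → Cell) (l : ℕ) : Prop :=
  0 < l ∧ (∀ i : ℤ, NW (e i) (e (i + 1))) ∧ ∀ i : ℤ, tauC m n (e i) = e (i + l)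

def IsStreamEnum' (m n : ℕ) (e : ℤ → Cell) (l : ℕ) : Prop :=
  0 < l ∧ (∀ i : ℤ, nWgt (e i) (e (i + 1))) ∧ ∀ i : ℤ, tauC m n (e i) = e (i + l)

def IsStream (m n : ℕ) (S : Set Cell) (l : ℕ) : Prop :=
  ∃ e : ℤ → Cell, IsStreamEnum m n e l ∧ Set.range e = S

def IsStream' (m n : ℕ) (S : Set Cell) (l : ℕ) : Prop :=
  ∃ e : ℤ → Cell, IsStreamEnum' m n e l ∧ Set.range e = S

/-- A channel of `A`: a stream contained in `supp A` of maximal flow. -/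
def IsChannel (m n : ℕ) (A : Mat) (C : Set Cell) : Prop :=
  ∃ l : ℕ, IsStream m n C l ∧ C ⊆ supp A ∧
    ∀ (S : Set Cell) (l' : ℕ), IsStream m n S l' → S ⊆ supp A → l' ≤ l

def IsChannel' (m n : ℕ) (A : Mat) (C : Set Cell) : Prop :=
  ∃ l : ℕ, IsStream' m n C l ∧ C ⊆ supp A ∧
    ∀ (S : Set Cell) (l' : ℕ), IsStream' m n S l' → S ⊆ supp A → l' ≤ l

def Csw (A : Mat) (C : Set Cell) : Set Cell :=
  {c ∈ supp A | ∃ c' ∈ C, neLe c c'}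

def Csw' (A : Mat) (C : Set Cell) : Set Cell :=
  {c ∈ supp A | c ∈ C ∨ ∃ c' ∈ C, NeLt c c'}

/-- `swGe A C₁ C₂` means `C₁ ≽_sw C₂`. -/
def swGe (A : Mat) (C₁ C₂ : Set Cell) : Prop := C₁ ⊆ Csw A C₂

def swGe' (A : Mat) (C₁ C₂ : Set Cell) : Prop := C₁ ⊆ Csw' A C₂

/-- The set of values `d₀(c'_k) + k` over `>_NW`-chains from `c` to the channel
enumerated by `e` (where `d₀ (e idx) = idx`). -/
def chainSet (A : Mat) (e : ℤ → Cell) (c : Cell) : Set ℤ :=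
  {v : ℤ | ∃ (k : ℕ) (ch : ℕ → Cell),
      ch 0 = c ∧ (∀ i ≤ k, ch i ∈ supp A) ∧ (∀ i < k, NW (ch (i + 1)) (ch i)) ∧
        ∃ idx : ℤ, e idx = ch k ∧ v = idx + (k : ℤ)}

def chainSet' (A : Mat) (e : ℤ → Cell) (c : Cell) : Set ℤ :=
  {v : ℤ | ∃ (k : ℕ) (ch : ℕ → Cell),
      ch 0 = c ∧ (∀ i ≤ k, ch i ∈ supp A) ∧ (∀ i < k, nWgt (ch (i + 1)) (ch i)) ∧
        ∃ idx : ℤ, e idx = ch k ∧ v = idx + (k : ℤ)}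

/-- `d` is the channel numbering `d^C_A` for the channel enumerated by `e`. -/
def IsChannelNumbering (A : Mat) (e : ℤ → Cell) (d : Cell → ℤ) : Prop :=
  ∀ c ∈ supp A, IsGreatest (chainSet A e c) (d c)

def IsChannelNumbering' (A : Mat) (e : ℤ → Cell) (d : Cell → ℤ) : Prop :=
  ∀ c ∈ supp A, IsGreatest (chainSet' A e c) (d c)

/-- `e` enumerates the southwest channel of `A`. -/
def IsSWChannelEnum (m n : ℕ) (A : Mat) (e : ℤ → Cell) : Prop :=
  (∃ l : ℕ, IsStreamEnum m n e l) ∧ IsChannel m n A (Set.range e) ∧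
    ∀ C : Set Cell, IsChannel m n A C → swGe A (Set.range e) C

def IsSWChannelEnum' (m n : ℕ) (A : Mat) (e : ℤ → Cell) : Prop :=
  (∃ l : ℕ, IsStreamEnum' m n e l) ∧ IsChannel' m n A (Set.range e) ∧
    ∀ C : Set Cell, IsChannel' m n A C → swGe' A (Set.range e) C

/-- `d` is a southwest channel numbering of `A`. -/
def IsSWNumbering (m n : ℕ) (A : Mat) (d : Cell → ℤ) : Prop :=
  ∃ e : ℤ → Cell, IsSWChannelEnum m n A e ∧ IsChannelNumbering A e d

def IsSWNumbering' (m n : ℕ) (A : Mat) (d : Cell → ℤ) : Prop :=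
  ∃ e : ℤ → Cell, IsSWChannelEnum' m n A e ∧ IsChannelNumbering' A e d

/-- A zig-zag: bi-infinite east/north lattice path, eventually east on the
right and coming from the south on the left. -/
def IsZigZag (z : ℤ → Cell) : Prop :=
  (∀ i : ℤ, z (i + 1) = ((z i).1, (z i).2 + 1) ∨ z (i + 1) = ((z i).1 - 1, (z i).2)) ∧
  (∃ N : ℤ, ∀ i : ℤ, N ≤ i → z (i + 1) = ((z i).1, (z i).2 + 1)) ∧
    ∃ N : ℤ, ∀ i : ℤ, i ≤ N → z (i + 1) = ((z i).1 - 1, (z i).2)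

def innerCorners (z : ℤ → Cell) : Set Cell :=
  {c : Cell | ∃ i : ℤ, z i = c ∧ z i = ((z (i - 1)).1 - 1, (z (i - 1)).2) ∧
      z (i + 1) = ((z i).1, (z i).2 + 1)}

def outerCorners (z : ℤ → Cell) : Set Cell :=
  {c : Cell | ∃ i : ℤ, z i = c ∧ z i = ((z (i - 1)).1, (z (i - 1)).2 + 1) ∧
      z (i + 1) = ((z i).1 - 1, (z i).2)}

def levelSet (A : Mat) (d : Cell → ℤ) (k : ℤ) : Set Cell := {c ∈ supp A | d c = k}

/-- `≥_nw`-maximal cells of `S`. -/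
def nwMaximal (S : Set Cell) : Set Cell := {c ∈ S | ∀ c' ∈ S, nwGe c' c → c' = c}

/-- `>_nW`-maximal cells of `S` (dual). -/
def nWMaximal (S : Set Cell) : Set Cell := {c ∈ S | ∀ c' ∈ S, ¬ nWgt c' c}

/-- `z` is the zig-zag at level `k` associated to the numbering `d`. -/
def ZigZagAt (A : Mat) (d : Cell → ℤ) (k : ℤ) (z : ℤ → Cell) : Prop :=
  IsZigZag z ∧ innerCorners z = nwMaximal (levelSet A d k)

def ZigZagAt' (A : Mat) (d : Cell → ℤ) (k : ℤ) (z : ℤ → Cell) : Prop :=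
  IsZigZag z ∧ innerCorners z = nWMaximal (levelSet A d k)

def IsInnerOf (A : Mat) (d : Cell → ℤ) (c : Cell) : Prop :=
  ∃ (k : ℤ) (z : ℤ → Cell), ZigZagAt A d k z ∧ c ∈ innerCorners z

def IsOuterOf (A : Mat) (d : Cell → ℤ) (c : Cell) : Prop :=
  ∃ (k : ℤ) (z : ℤ → Cell), ZigZagAt A d k z ∧ c ∈ outerCorners z

def IsInnerOf' (A : Mat) (d : Cell → ℤ) (c : Cell) : Prop :=
  ∃ (k : ℤ) (z : ℤ → Cell), ZigZagAt' A d k z ∧ c ∈ innerCorners z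

def IsOuterOf' (A : Mat) (d : Cell → ℤ) (c : Cell) : Prop :=
  ∃ (k : ℤ) (z : ℤ → Cell), ZigZagAt' A d k z ∧ c ∈ outerCorners z

/-- `B` is obtained from `A` by subtracting `1` at inner corners and adding `1`
at outer corners. -/
def FlatEntries (A B : Mat) (Inn Out : Cell → Prop) : Prop :=
  ∀ c : Cell,
    (Inn c → B c.1 c.2 + 1 = A c.1 c.2) ∧
    (Out c → B c.1 c.2 = A c.1 c.2 + 1) ∧
    (¬ Inn c → ¬ Out c → B c.1 c.2 = A c.1 c.2)

/-- `B = A^♭`. -/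
def FlatRel (m n : ℕ) (A B : Mat) : Prop :=
  ∃ d : Cell → ℤ, IsSWNumbering m n A d ∧
    FlatEntries A B (IsInnerOf A d) (IsOuterOf A d)

/-- `B = A^{♭'}` (dual). -/
def FlatRel' (m n : ℕ) (A B : Mat) : Prop :=
  ∃ d : Cell → ℤ, IsSWNumbering' m n A d ∧
    FlatEntries A B (IsInnerOf' A d) (IsOuterOf' A d)

/-- `c` is the back-post corner of the zig-zag `z`:
`(row of rightmost inner corner, column of leftmost inner corner)`. -/
def IsBackPost (z : ℤ → Cell) (c : Cell) : Prop :=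
  ∃ cr ∈ innerCorners z, ∃ cl ∈ innerCorners z,
    (∀ c' ∈ innerCorners z, c'.2 ≤ cr.2) ∧ (∀ c' ∈ innerCorners z, cl.2 ≤ c'.2) ∧
      c = (cr.1, cl.2)

def backPostSet (A : Mat) (d : Cell → ℤ) : Set Cell :=
  {c : Cell | ∃ (k : ℤ) (z : ℤ → Cell), ZigZagAt A d k z ∧ IsBackPost z c}

def backPostSet' (A : Mat) (d : Cell → ℤ) : Set Cell :=
  {c : Cell | ∃ (k : ℤ) (z : ℤ → Cell), ZigZagAt' A d k z ∧ IsBackPost z c}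

/-- Defining data `(a, b, r)` of the stream enumerated by `e` of flow `l`. -/
def StreamData (m n : ℕ) (e : ℤ → Cell) (l : ℕ) (a b : ℕ → ℤ) (r : ℤ) : Prop :=
  ∃ r₁ r₂ : ℤ,
    (∀ p : ℕ, p < l → a p = (e (r₁ + 1 + p)).1 ∧ 1 ≤ a p ∧ a p ≤ (m : ℤ)) ∧
    (∀ p : ℕ, p < l → b p = (e (r₂ + 1 + p)).2 ∧ 1 ≤ b p ∧ b p ≤ (n : ℤ)) ∧
      r = r₁ - r₂

/-- The matrix-ball iteration `A = A^(0), A^(t) = (A^(t-1))^♭`, with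
`A^(t) ≠ O` for `t < s` and `A^(s) = O`. -/
def MBCseq (m n : ℕ) (A : Mat) (s : ℕ) (Aseq : ℕ → Mat) : Prop :=
  Aseq 0 = A ∧ (∀ t < s, Aseq t ≠ 0) ∧ Aseq s = 0 ∧
    ∀ t < s, FlatRel m n (Aseq t) (Aseq (t + 1))

def MBCseq' (m n : ℕ) (A : Mat) (s : ℕ) (Aseq : ℕ → Mat) : Prop :=
  Aseq 0 = A ∧ (∀ t < s, Aseq t ≠ 0) ∧ Aseq s = 0 ∧
    ∀ t < s, FlatRel' m n (Aseq t) (Aseq (t + 1))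

/-- `κ₀(A) = (P, Q, ρ)`, with shape given by the column lengths `μ`:
the `t`-th columns (from the left, `0`-based) of `P` and `Q` are the defining
data of the stream of back-post corners of the zig-zags of `d^{sw}_{A^(t)}`. -/
def Kappa0Rel (m n : ℕ) (A : Mat) (s : ℕ) (μ : ℕ → ℕ) (P Q : ℕ → ℕ → ℤ)
    (ρ : ℕ → ℤ) : Prop :=
  ∃ Aseq : ℕ → Mat, MBCseq m n A s Aseq ∧
    ∀ t < s, ∃ (d : Cell → ℤ) (e : ℤ → Cell),
      IsSWNumbering m n (Aseq t) d ∧ IsStreamEnum m n e (μ t) ∧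
        Set.range e = backPostSet (Aseq t) d ∧
        StreamData m n e (μ t) (fun x => P x t) (fun x => Q x t) (ρ t)

def Kappa0Rel' (m n : ℕ) (A : Mat) (s : ℕ) (μ : ℕ → ℕ) (P Q : ℕ → ℕ → ℤ)
    (ρ : ℕ → ℤ) : Prop :=
  ∃ Aseq : ℕ → Mat, MBCseq' m n A s Aseq ∧
    ∀ t < s, ∃ (d : Cell → ℤ) (e : ℤ → Cell),
      IsSWNumbering' m n (Aseq t) d ∧ IsStreamEnum' m n e (μ t) ∧
        Set.range e = backPostSet' (Aseq t) d ∧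
        StreamData m n e (μ t) (fun x => P x t) (fun x => Q x t) (ρ t)

/-! ### Columns and the shift `τ` -/

/-- Extension of a column `c` of length `b` to `ℤ`: `c̃(x + bq) = c(x) + nq`. -/
def colExt (n b : ℕ) (c : ℕ → ℤ) (z : ℤ) : ℤ :=
  c (Int.toNat (Int.emod z (b : ℤ))) + (n : ℤ) * Int.ediv z (b : ℤ)

/-- `τ_n^k` applied to a column of length `b`. -/
def tauPow (n b : ℕ) (k : ℤ) (c : ℕ → ℤ) : ℕ → ℤ :=
  fun x => colExt n b c ((x : ℤ) + k)

/-- The two-column tableau `(column t of T, τ_N^r(column (t+1) of T))`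
(both of height `μ t`) is `ℤ`-semistandard. -/
def pairCond (N : ℕ) (μ : ℕ → ℕ) (T : ℕ → ℕ → ℤ) (t : ℕ) (r : ℕ) : Prop :=
  (∀ x : ℕ, x + 1 < μ t → T x t < T (x + 1) t) ∧
  (∀ x : ℕ, x + 1 < μ t →
    tauPow N (μ t) (r : ℤ) (fun y => T y (t + 1)) x <
      tauPow N (μ t) (r : ℤ) (fun y => T y (t + 1)) (x + 1)) ∧
    ∀ x < μ t, T x t ≤ tauPow N (μ t) (r : ℤ) (fun y => T y (t + 1)) x

/-- The offset `r` for the adjacent pair of columns `(t, t+1)`. -/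
noncomputable def rOff (N : ℕ) (μ : ℕ → ℕ) (T : ℕ → ℕ → ℤ) (t : ℕ) : ℕ :=
  sInf {r : ℕ | pairCond N μ T t r}

/-- Dual version: placing row `t` above row `τ_N^r(row (t+1))` (rows of the
transposed tableau, i.e. columns of `T`) is `ℤ`-semistandard. -/
def dualPairCond (N : ℕ) (μ : ℕ → ℕ) (T : ℕ → ℕ → ℤ) (t : ℕ) (r : ℕ) : Prop :=
  (∀ x : ℕ, x + 1 < μ t → T x t ≤ T (x + 1) t) ∧
  (∀ x : ℕ, x + 1 < μ t →
    tauPow N (μ t) (r : ℤ) (fun y => T y (t + 1)) x ≤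
      tauPow N (μ t) (r : ℤ) (fun y => T y (t + 1)) (x + 1)) ∧
    ∀ x < μ t, T x t < tauPow N (μ t) (r : ℤ) (fun y => T y (t + 1)) x

noncomputable def rOffDual (N : ℕ) (μ : ℕ → ℕ) (T : ℕ → ℕ → ℤ) (t : ℕ) : ℕ :=
  sInf {r : ℕ | dualPairCond N μ T t r}

/-- First column of the rectangle block containing column `t`. -/
noncomputable def blockStart (μ : ℕ → ℕ) (t : ℕ) : ℕ := sInf {t' : ℕ | μ t' = μ t}

/-- The symmetrized offset entry attached to column `t`
(`η_j` where `j` is the position of `t` from the right in its block). -/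
noncomputable def etaCol (N : ℕ) (μ : ℕ → ℕ) (T : ℕ → ℕ → ℤ) (t : ℕ) : ℕ :=
  ∑ u ∈ Finset.Ico (blockStart μ t) t, rOff N μ T u

noncomputable def etaColDual (N : ℕ) (μ : ℕ → ℕ) (T : ℕ → ℕ → ℤ) (t : ℕ) : ℕ :=
  ∑ u ∈ Finset.Ico (blockStart μ t) t, rOffDual N μ T u

/-- Entries outside the shape are normalized to `0`. -/
def PadZeroT (s : ℕ) (μ : ℕ → ℕ) (T : ℕ → ℕ → ℤ) : Prop :=
  ∀ x t : ℕ, s ≤ t ∨ μ t ≤ x → T x t = 0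

/-- `μ` encodes (the conjugate of) a partition `λ ∈ 𝒫_m ∩ 𝒫_n` with `s` columns. -/
def ShapeOK (m n s : ℕ) (μ : ℕ → ℕ) : Prop :=
  (∀ t : ℕ, t + 1 < s → μ (t + 1) ≤ μ t) ∧ (∀ t < s, 0 < μ t ∧ μ t ≤ m ∧ μ t ≤ n) ∧
    ∀ t : ℕ, s ≤ t → μ t = 0

/-- Dual shape condition: `λ ∈ 𝒫_n`. -/
def ShapeOK' (n s : ℕ) (μ : ℕ → ℕ) : Prop :=
  (∀ t : ℕ, t + 1 < s → μ (t + 1) ≤ μ t) ∧ (∀ t < s, 0 < μ t ∧ μ t ≤ n) ∧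
    ∀ t : ℕ, s ≤ t → μ t = 0

/-- `κ(A) = (P, Q)` where `Q` is obtained by shifting the `t`-th column of `Q₀`
by `τ_n^{ρ_t + η_t}` (`η` the symmetrized offset vector of `P₀`). -/
def KappaRel (m n : ℕ) (A : Mat) (s : ℕ) (μ : ℕ → ℕ) (P Q : ℕ → ℕ → ℤ) : Prop :=
  ∃ (P' Q' : ℕ → ℕ → ℤ) (ρ : ℕ → ℤ),
    Kappa0Rel m n A s μ P' Q' ρ ∧
    (∀ t < s, ∀ x < μ t,
      P x t = P' x t ∧
        Q x t = tauPow n (μ t) (ρ t + (etaCol m μ P' t : ℤ)) (fun y => Q' y t) x) ∧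
    PadZeroT s μ P ∧ PadZeroT s μ Q ∧ ∀ t : ℕ, s ≤ t → μ t = 0

def KappaRel' (m n : ℕ) (A : Mat) (s : ℕ) (μ : ℕ → ℕ) (P Q : ℕ → ℕ → ℤ) : Prop :=
  ∃ (P' Q' : ℕ → ℕ → ℤ) (ρ : ℕ → ℤ),
    Kappa0Rel' m n A s μ P' Q' ρ ∧
    (∀ t < s, ∀ x < μ t,
      P x t = P' x t ∧
        Q x t = tauPow n (μ t) (ρ t + (etaColDual m μ P' t : ℤ)) (fun y => Q' y t) x) ∧
    PadZeroT s μ P ∧ PadZeroT s μ Q ∧ ∀ t : ℕ, s ≤ t → μ t = 0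

/-- Membership in `⨆_{λ ∈ 𝒫_m ∩ 𝒫_n} CSST_[m](λ) × B_n(λ)`:
`P` is column semistandard with entries in `{1, …, m}` and `Q` is a
`ℤ`-semistandard filling whose columns span less than `n` and whose rows
weakly increase within each rectangle block. -/
def InTargetRSK (m n s : ℕ) (μ : ℕ → ℕ) (P Q : ℕ → ℕ → ℤ) : Prop :=
  ShapeOK m n s μ ∧ PadZeroT s μ P ∧ PadZeroT s μ Q ∧
  (∀ t < s, ∀ x : ℕ, x + 1 < μ t → P x t < P (x + 1) t) ∧
  (∀ t < s, ∀ x < μ t, 1 ≤ P x t ∧ P x t ≤ (m : ℤ)) ∧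
  (∀ t < s, ∀ x : ℕ, x + 1 < μ t → Q x t < Q (x + 1) t) ∧
  (∀ t < s, Q (μ t - 1) t - Q 0 t < (n : ℤ)) ∧
    ∀ t : ℕ, t + 1 < s → μ t = μ (t + 1) → ∀ x < μ t, Q x t ≤ Q x (t + 1)

/-- Membership in `⨆_{λ ∈ 𝒫_n} RSST_[m](λ') × B_n(λ)`; the first component is
encoded by `P = P₀` (whose columns, weakly increasing with entries in
`{1, …, m}`, are the rows of `P₀ᵗ ∈ RSST_[m](λ')`). -/
def InTargetDual (m n s : ℕ) (μ : ℕ → ℕ) (P Q : ℕ → ℕ → ℤ) : Prop :=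
  ShapeOK' n s μ ∧ PadZeroT s μ P ∧ PadZeroT s μ Q ∧
  (∀ t < s, ∀ x : ℕ, x + 1 < μ t → P x t ≤ P (x + 1) t) ∧
  (∀ t < s, ∀ x < μ t, 1 ≤ P x t ∧ P x t ≤ (m : ℤ)) ∧
  (∀ t < s, ∀ x : ℕ, x + 1 < μ t → Q x t < Q (x + 1) t) ∧
  (∀ t < s, Q (μ t - 1) t - Q 0 t < (n : ℤ)) ∧
    ∀ t : ℕ, t + 1 < s → μ t = μ (t + 1) → ∀ x < μ t, Q x t ≤ Q x (t + 1)

/-- Dominance of a triple `(P, Q, ρ)`: within each rectangle block, the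
sequence `ρ - ζ` (read right to left) is weakly decreasing, where
`ζ = θ - η` with `η`, `θ` the symmetrized offset vectors of `P`, `Q`. -/
def Dominant (m n s : ℕ) (μ : ℕ → ℕ) (P Q : ℕ → ℕ → ℤ) (ρ : ℕ → ℤ) : Prop :=
  ∀ t : ℕ, t + 1 < s → μ t = μ (t + 1) →
    ρ t - ((etaCol n μ Q t : ℤ) - (etaCol m μ P t : ℤ)) ≤
      ρ (t + 1) - ((etaCol n μ Q (t + 1) : ℤ) - (etaCol m μ P (t + 1) : ℤ))

/-- `κ₀(A) = (P, Q, ρ)` with all data normalized outside the shape. -/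
def Kappa0RelPad (m n : ℕ) (A : Mat) (s : ℕ) (μ : ℕ → ℕ) (P Q : ℕ → ℕ → ℤ)
    (ρ : ℕ → ℤ) : Prop :=
  ∃ P' Q' : ℕ → ℕ → ℤ,
    Kappa0Rel m n A s μ P' Q' ρ ∧
    (∀ t < s, ∀ x < μ t, P x t = P' x t ∧ Q x t = Q' x t) ∧
    PadZeroT s μ P ∧ PadZeroT s μ Q ∧ (∀ t : ℕ, s ≤ t → μ t = 0) ∧
      ∀ t : ℕ, s ≤ t → ρ t = 0

/-- Membership in `Ω_dom`. -/
def InOmegaDom (m n s : ℕ) (μ : ℕ → ℕ) (P Q : ℕ → ℕ → ℤ) (ρ : ℕ → ℤ) : Prop :=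
  ShapeOK m n s μ ∧ PadZeroT s μ P ∧ PadZeroT s μ Q ∧ (∀ t : ℕ, s ≤ t → ρ t = 0) ∧
  (∀ t < s, ∀ x : ℕ, x + 1 < μ t → P x t < P (x + 1) t) ∧
  (∀ t < s, ∀ x < μ t, 1 ≤ P x t ∧ P x t ≤ (m : ℤ)) ∧
  (∀ t < s, ∀ x : ℕ, x + 1 < μ t → Q x t < Q (x + 1) t) ∧
  (∀ t < s, ∀ x < μ t, 1 ≤ Q x t ∧ Q x t ≤ (n : ℤ)) ∧
    Dominant m n s μ P Q ρ

/-- `A` has width `l`: some proper numbering has period `l`. -/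
def HasWidth (m n : ℕ) (A : Mat) (l : ℕ) : Prop :=
  ∃ d : Cell → ℤ, IsProper A d ∧ ∀ c ∈ supp A, d (tauC m n c) = d c + (l : ℤ)

/-! ### Crystal operators on matrices -/

/-- The first `+` of column `j` (row `i`) survives the signature reduction of
the sequence `σ` attached to rows `i, i+1`. -/
def SurvPlus (A : Mat) (i j : ℤ) : Prop :=
  0 < A i j ∧ ∀ j' : ℤ, j < j' →
    (∑ t ∈ Finset.Ioc j j', A (i + 1) t) ≤ (A i j - 1) + ∑ t ∈ Finset.Ioo j j', A i t

/-- The last `-` of column `j` (row `i+1`) survives the reduction. -/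
def SurvMinus (A : Mat) (i j : ℤ) : Prop :=
  0 < A (i + 1) j ∧ ∀ j' : ℤ, j' < j →
    (∑ t ∈ Finset.Ico j' j, A i t) ≤ (A (i + 1) j - 1) + ∑ t ∈ Finset.Ioo j' j, A (i + 1) t

/-- `A - Ê_{i₁ j} + Ê_{i₂ j}`. -/
noncomputable def subAddAt (m n : ℕ) (i₁ i₂ j : ℤ) (A : Mat) : Mat :=
  fun x y =>
    if ∃ k : ℤ, x = i₁ + k * m ∧ y = j + k * n then A x y - 1
    else if ∃ k : ℤ, x = i₂ + k * m ∧ y = j + k * n then A x y + 1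
    else A x y

/-- `f̃_i` on `M̂_{m×n}`, `0`-valued results encoded by `none`. -/
noncomputable def fMat (m n : ℕ) (i : ℤ) (A : Mat) : Option Mat :=
  if h : ∃ j : ℤ, SurvPlus A i j ∧ ∀ j' : ℤ, SurvPlus A i j' → j ≤ j' then
    some (subAddAt m n i (i + 1) h.choose A)
  else none

/-- `ẽ_i` on `M̂_{m×n}`. -/
noncomputable def eMat (m n : ℕ) (i : ℤ) (A : Mat) : Option Mat :=
  if h : ∃ j : ℤ, SurvMinus A i j ∧ ∀ j' : ℤ, SurvMinus A i j' → j' ≤ j then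
    some (subAddAt m n (i + 1) i h.choose A)
  else none

def transM (A : Mat) : Mat := fun i j => A j i

/-- `f̃^t_j A = (f̃_j (Aᵗ))ᵗ`. -/
noncomputable def fMatT (m n : ℕ) (j : ℤ) (A : Mat) : Option Mat :=
  (fMat n m j (transM A)).map transM

/-- `ẽ^t_j A = (ẽ_j (Aᵗ))ᵗ`. -/
noncomputable def eMatT (m n : ℕ) (j : ℤ) (A : Mat) : Option Mat :=
  (eMat n m j (transM A)).map transM

/-- Row operator (`f̃_i` if `x = true`, `ẽ_i` if `x = false`) on `M̂ ∪ {0}`. -/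
noncomputable def rowOp (m n : ℕ) (x : Bool) (i : ℤ) (o : Option Mat) : Option Mat :=
  o.bind (if x then fMat m n i else eMat m n i)

/-- Column operator (`f̃^t_j` or `ẽ^t_j`) on `M̂ ∪ {0}`. -/
noncomputable def colOp (m n : ℕ) (y : Bool) (j : ℤ) (o : Option Mat) : Option Mat :=
  o.bind (if y then fMatT m n j else eMatT m n j)

/-- The `+` of row `u`, column `j` survives the signature reduction of the
sequence attached to columns `j, j+1` (read along rows, top to bottom). -/
def ColSurvPlus (A : Mat) (j u : ℤ) : Prop :=
  0 < A u j ∧ ∀ u' : ℤ, u < u' →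
    (∑ i ∈ Finset.Ioc u u', A i (j + 1)) ≤ (A u j - 1) + ∑ i ∈ Finset.Ioo u u', A i j

/-- `A - Ê_{u j} + Ê_{u, j+1}`, the result of `f̃^t_j` acting at row `u`. -/
noncomputable def ftApply (m n : ℕ) (u j : ℤ) (A : Mat) : Mat :=
  fun x y =>
    if ∃ k : ℤ, x = u + k * m ∧ y = j + k * n then A x y - 1
    else if ∃ k : ℤ, x = u + k * m ∧ y = j + 1 + k * n then A x y + 1
    else A x y

/-! ### Crystal operators on tableaux -/

/-- Column `t` of `P` contributes a `+` for the letter `i`. -/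
def PhasPlus (μ : ℕ → ℕ) (P : ℕ → ℕ → ℤ) (i : ℤ) (t : ℕ) : Prop :=
  (∃ x < μ t, P x t = i) ∧ ∀ x < μ t, P x t ≠ i + 1

/-- Column `t` of `P` contributes a `-` for the letter `i`. -/
def PhasMinus (μ : ℕ → ℕ) (P : ℕ → ℕ → ℤ) (i : ℤ) (t : ℕ) : Prop :=
  (∃ x < μ t, P x t = i + 1) ∧ ∀ x < μ t, P x t ≠ i

/-- The `+` of column `t` survives the tensor-product signature reduction
(factors are the columns read from right to left). -/
def PSurvPlus (μ : ℕ → ℕ) (P : ℕ → ℕ → ℤ) (i : ℤ) (t : ℕ) : Prop :=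
  PhasPlus μ P i t ∧ ∀ t' < t,
    ((Finset.Ico t' t).filter (fun u => PhasMinus μ P i u)).card ≤
      ((Finset.Ioo t' t).filter (fun u => PhasPlus μ P i u)).card

def PSurvMinus (μ : ℕ → ℕ) (P : ℕ → ℕ → ℤ) (i : ℤ) (t : ℕ) : Prop :=
  PhasMinus μ P i t ∧ ∀ t'' : ℕ, t < t'' →
    ((Finset.Ioc t t'').filter (fun u => PhasPlus μ P i u)).card ≤
      ((Finset.Ioo t t'').filter (fun u => PhasMinus μ P i u)).card

/-- `f̃_i` on `P` acting on column `t₀` (replace the letter `i` by `i + 1`). -/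
noncomputable def applyPF (μ : ℕ → ℕ) (P : ℕ → ℕ → ℤ) (i : ℤ) (t₀ : ℕ) :
    ℕ → ℕ → ℤ :=
  fun x t => if t = t₀ ∧ x < μ t ∧ P x t = i then i + 1 else P x t

/-- `ẽ_i` on `P` acting on column `t₀`. -/
noncomputable def applyPE (μ : ℕ → ℕ) (P : ℕ → ℕ → ℤ) (i : ℤ) (t₀ : ℕ) :
    ℕ → ℕ → ℤ :=
  fun x t => if t = t₀ ∧ x < μ t ∧ P x t = i + 1 then i else P x t

/-- The entry at position `k` of a column `c` of height `b` can be increased. -/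
def QmovUp (n b : ℕ) (c : ℕ → ℤ) (k : ℕ) : Prop :=
  (k + 1 < b ∧ c k + 1 < c (k + 1)) ∨ (k + 1 = b ∧ c (b - 1) < c 0 + (n : ℤ) - 1)

/-- The entry at position `k` of a column `c` of height `b` can be decreased. -/
def QmovDown (n b : ℕ) (c : ℕ → ℤ) (k : ℕ) : Prop :=
  (0 < k ∧ c (k - 1) < c k - 1) ∨ (k = 0 ∧ c (b - 1) < c 0 + (n : ℤ) - 1)

def QhasPlus (n : ℕ) (μ : ℕ → ℕ) (Q : ℕ → ℕ → ℤ) (j : ℤ) (t : ℕ) : Prop :=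
  ∃ k < μ t, Int.emod (Q k t) (n : ℤ) = j ∧ QmovUp n (μ t) (fun y => Q y t) k

def QhasMinus (n : ℕ) (μ : ℕ → ℕ) (Q : ℕ → ℕ → ℤ) (j : ℤ) (t : ℕ) : Prop :=
  ∃ k < μ t, Int.emod (Q k t) (n : ℤ) = Int.emod (j + 1) (n : ℤ) ∧
    QmovDown n (μ t) (fun y => Q y t) k

def QSurvPlus (n : ℕ) (μ : ℕ → ℕ) (Q : ℕ → ℕ → ℤ) (j : ℤ) (t : ℕ) : Prop :=
  QhasPlus n μ Q j t ∧ ∀ t' < t,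
    ((Finset.Ico t' t).filter (fun u => QhasMinus n μ Q j u)).card ≤
      ((Finset.Ioo t' t).filter (fun u => QhasPlus n μ Q j u)).card

def QSurvMinus (n : ℕ) (μ : ℕ → ℕ) (Q : ℕ → ℕ → ℤ) (j : ℤ) (t : ℕ) : Prop :=
  QhasMinus n μ Q j t ∧ ∀ t'' : ℕ, t < t'' →
    ((Finset.Ioc t t'').filter (fun u => QhasPlus n μ Q j u)).card ≤
      ((Finset.Ioo t t'').filter (fun u => QhasMinus n μ Q j u)).card

/-- `f̃^t_j` on `Q` acting on column `t₀`. -/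
noncomputable def applyQF (n : ℕ) (μ : ℕ → ℕ) (Q : ℕ → ℕ → ℤ) (j : ℤ) (t₀ : ℕ) :
    ℕ → ℕ → ℤ :=
  fun x t =>
    if t = t₀ ∧ x < μ t ∧ Int.emod (Q x t) (n : ℤ) = j ∧
        QmovUp n (μ t) (fun y => Q y t) x
    then Q x t + 1 else Q x t

/-- `ẽ^t_j` on `Q` acting on column `t₀`. -/
noncomputable def applyQE (n : ℕ) (μ : ℕ → ℕ) (Q : ℕ → ℕ → ℤ) (j : ℤ) (t₀ : ℕ) :
    ℕ → ℕ → ℤ :=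
  fun x t =>
    if t = t₀ ∧ x < μ t ∧ Int.emod (Q x t) (n : ℤ) = Int.emod (j + 1) (n : ℤ) ∧
        QmovDown n (μ t) (fun y => Q y t) x
    then Q x t - 1 else Q x t

/-! ### Standardization -/

noncomputable def rowSumA (A : Mat) (i : ℤ) : ℕ := ∑ᶠ j : ℤ, A i j

noncomputable def colSumA (A : Mat) (j : ℤ) : ℕ := ∑ᶠ i : ℤ, A i j

/-- `A ∈ M̂_{m×n}(α, β)`. -/
def InMhatAB (m n : ℕ) (α β : ℕ → ℕ) (A : Mat) : Prop :=
  IsGAP m n A ∧ (∀ i : ℕ, 1 ≤ i → i ≤ m → rowSumA A i = α i) ∧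
    ∀ j : ℕ, 1 ≤ j → j ≤ n → colSumA A j = β j

/-- Extended affine permutations `W̃_K`. -/
def IsEAP (K : ℕ) (B : Mat) : Prop :=
  IsGAP K K B ∧ (∀ i j : ℤ, B i j ≤ 1) ∧ (∀ i : ℤ, ∃! j : ℤ, B i j ≠ 0) ∧
    ∀ j : ℤ, ∃! i : ℤ, B i j ≠ 0

/-- `i` is a descent of the matrix `B`. -/
def IsDescentM (B : Mat) (i : ℤ) : Prop :=
  ∃ j j' : ℤ, B i j ≠ 0 ∧ B (i + 1) j' ≠ 0 ∧ j' < j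

/-- Partial sums `α₁ + ⋯ + α_i`. -/
def psum (α : ℕ → ℕ) (i : ℕ) : ℕ := ∑ u ∈ Finset.Icc 1 i, α u

/-- `B` is `α`-descending. -/
def AlphaDescending (m : ℕ) (α : ℕ → ℕ) (B : Mat) : Prop :=
  ∀ k : ℕ, 1 ≤ k → k ≤ m → ∀ i : ℤ,
    (psum α (k - 1) : ℤ) < i → i < (psum α k : ℤ) → IsDescentM B i

/-- `B` is `(α, β)`-descending. -/
def IsABDescending (m n : ℕ) (α β : ℕ → ℕ) (B : Mat) : Prop :=
  AlphaDescending m α B ∧ AlphaDescending n β (transM B)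

/-- `B` standardizes `A`: blockwise entry sums of `B` over `𝓘_i × 𝓙_j`
equal the entries of `A`. -/
def PermOf (m n K : ℕ) (α β : ℕ → ℕ) (A B : Mat) : Prop :=
  ∀ (i₀ j₀ : ℕ) (q r : ℤ), 1 ≤ i₀ → i₀ ≤ m → 1 ≤ j₀ → j₀ ≤ n →
    A ((i₀ : ℤ) + q * m) ((j₀ : ℤ) + r * n) =
      ∑ k ∈ Finset.Icc ((psum α (i₀ - 1) : ℤ) + q * K + 1) ((psum α i₀ : ℤ) + q * K),
        ∑ l ∈ Finset.Icc ((psum β (j₀ - 1) : ℤ) + r * K + 1) ((psum β j₀ : ℤ) + r * K),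
          B k l

/-- Standardization of a column-semistandard tableau: for each value `v`, its
occurrences, from left to right, are replaced by consecutive integers starting
after the number of strictly smaller entries. -/
noncomputable def stdT (s : ℕ) (μ : ℕ → ℕ) (T : ℕ → ℕ → ℤ) : ℕ → ℕ → ℤ :=
  fun x t =>
    ((∑ t' ∈ Finset.range s,
        ((Finset.range (μ t')).filter (fun x' => T x' t' < T x t)).card : ℕ) : ℤ) +
      (((Finset.range t).filter (fun t' => ∃ x' < μ t', T x' t' = T x t)).card : ℤ) + 1

/-- `i` is a (column) descent of the tableau `T`: the letter `i + 1` occurs in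
a column strictly to the right of the column containing `i`. -/
def IsDescentT (s : ℕ) (μ : ℕ → ℕ) (T : ℕ → ℕ → ℤ) (i : ℤ) : Prop :=
  ∃ t < s, ∃ t' < s, ∃ x < μ t, ∃ x' < μ t', T x t = i ∧ T x' t' = i + 1 ∧ t < t'

/-! ### Rectangles, `B_n(R)` and `B_n(R)₀` (columns indexed from the right) -/

/-- `T ∈ B_n(R)` for the rectangle `R = (a^b)`; `T j x` is the entry at row `x`
of the `(j+1)`-st column from the right, normalized to `0` outside the shape. -/
def InBnR (n a b : ℕ) (T : ℕ → ℕ → ℤ) : Prop :=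
  (∀ j : ℕ, j + 1 < a → ∀ x < b, T (j + 1) x ≤ T j x) ∧
  (∀ j < a, ∀ x : ℕ, x + 1 < b → T j x < T j (x + 1)) ∧
  (∀ j < a, T j (b - 1) - T j 0 < (n : ℤ)) ∧
    ∀ j x : ℕ, a ≤ j ∨ b ≤ x → T j x = 0

/-- `T ∈ B_n(R)₀`: `(T^{j+1}, τ_n^{-1}(T^j))` is not semistandard for any `j`. -/
def InBnR0 (n a b : ℕ) (T : ℕ → ℕ → ℤ) : Prop :=
  InBnR n a b T ∧
    ∀ j : ℕ, j + 1 < a → ¬ ∀ x < b, T (j + 1) x ≤ tauPow n b (-1) (fun y => T j y) x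

/-- `ν ∈ 𝒫_{a-1}`: a partition `ν₁ ≥ ⋯ ≥ ν_{a-1} ≥ 0`, normalized. -/
def IsPartLen (a : ℕ) (ν : ℕ → ℕ) : Prop :=
  ν 0 = 0 ∧ (∀ j : ℕ, 1 ≤ j → j + 2 ≤ a → ν (j + 1) ≤ ν j) ∧ ∀ j : ℕ, a ≤ j → ν j = 0

/-- `(T, ν) ↦ τ_n^{ν_rev}(T)`: the column `j` (from the right, 0-based) is
shifted by `τ_n^{ν_{j+1}}`. -/
noncomputable def PhiMap (n a b : ℕ) (T : ℕ → ℕ → ℤ) (ν : ℕ → ℕ) : ℕ → ℕ → ℤ :=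
  fun j x => if j < a ∧ x < b then tauPow n b ((ν (j + 1) : ℤ)) (fun y => T j y) x else 0

/-- The offset `r_j` of `T` (columns from the right, paper indexing `j ≥ 1`). -/
noncomputable def rOffR (n b : ℕ) (T : ℕ → ℕ → ℤ) (j : ℕ) : ℕ :=
  sInf {r : ℕ | ∀ x < b, T j x ≤ tauPow n b ((r : ℤ)) (fun y => T (j - 1) y) x}

/-- The symmetrized offset `η_j = r_j + ⋯ + r_{a-1}`. -/
noncomputable def etaR (n a b : ℕ) (T : ℕ → ℕ → ℤ) (j : ℕ) : ℕ :=
  ∑ u ∈ Finset.Icc j (a - 1), rOffR n b T u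

/-! ### The two-column setup -/

/-- Row coordinates of the stream with defining data `(a, ·, ρ)`:
`X(p + ρ + ql) = a(p) + qm` for `1 ≤ p ≤ l`. -/
def streamX (m l : ℕ) (a : ℕ → ℤ) (ρ : ℤ) (idx : ℤ) : ℤ := colExt m l a (idx - ρ - 1)

/-- Column coordinates: `Y(p + ql) = b(p) + qn` for `1 ≤ p ≤ l`. -/
def streamY (n l : ℕ) (b : ℕ → ℤ) (idx : ℤ) : ℤ := colExt n l b (idx - 1)

/-- The matrix built from the interleaved streams `t` and `t'`. -/
noncomputable def twoColMat (m n l : ℕ) (a1 a2 b1 b2 : ℕ → ℤ) (ρ₁ ρ₂ k : ℤ) : Mat :=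
  fun x y =>
    (if ∃ i : ℤ, streamX m l a2 ρ₂ (i + k) = x ∧ streamY n l b1 i = y then 1 else 0) +
      (if ∃ i : ℤ, streamX m l a1 ρ₁ i = x ∧ streamY n l b2 (i + k) = y then 1 else 0)


theorem colExt_val (n b : ℕ) (hb : 1 ≤ b) (c : ℕ → ℤ) (m : ℕ) (hm : m < b) (q : ℤ) :
    colExt n b c ((m : ℤ) + b * q) = c m + n * q := by
  have h1 : ((m : ℤ) + b * q) % (b : ℤ) = m := by
    rw [Int.add_mul_emod_self_left]
    exact Int.emod_eq_of_lt (by omega) (by omega)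
  have h2 : ((m : ℤ) + b * q) / (b : ℤ) = q := by
    rw [Int.add_mul_ediv_left _ _ (by omega), Int.ediv_eq_zero_of_lt (by omega) (by omega)]
    ring
  change c (Int.toNat (((m : ℤ) + b * q) % (b : ℤ))) + n * (((m : ℤ) + b * q) / (b : ℤ)) = _
  rw [h1, h2]
  simp

theorem exists_rep (b : ℕ) (hb : 1 ≤ b) (z : ℤ) :
    ∃ m : ℕ, m < b ∧ ∃ q : ℤ, z = (m : ℤ) + b * q := by
  have h0 := Int.emod_nonneg z (b := (b : ℤ)) (by omega)
  have h1 := Int.emod_lt_of_pos z (b := (b : ℤ)) (by omega)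
  refine ⟨(z % b).toNat, by omega, z / b, ?_⟩
  rw [Int.toNat_of_nonneg h0]
  exact (Int.emod_add_mul_ediv z b).symm

theorem colExt_add_mul (n b : ℕ) (hb : 1 ≤ b) (c : ℕ → ℤ) (z q : ℤ) :
    colExt n b c (z + b * q) = colExt n b c z + n * q := by
  obtain ⟨m, hm, p, rfl⟩ := exists_rep b hb z
  rw [show (m : ℤ) + b * p + b * q = m + b * (p + q) by ring,
    colExt_val n b hb c m hm, colExt_val n b hb c m hm]
  ring

/-- A column with entries in `{1, …, n}`. -/
def GoodCol (n b : ℕ) (c : ℕ → ℤ) : Prop :=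
  (∀ x : ℕ, x + 1 < b → c x < c (x + 1)) ∧ ∀ x < b, 1 ≤ c x ∧ c x ≤ (n : ℤ)

theorem colExt_strictMono (n b : ℕ) (hb : 1 ≤ b) (c : ℕ → ℤ) (hc : GoodCol n b c) :
    StrictMono (colExt n b c) := by
  apply strictMono_int_of_lt_succ
  intro z
  obtain ⟨m, hm, p, rfl⟩ := exists_rep b hb z
  rw [colExt_val n b hb c m hm]
  by_cases h : m + 1 < b
  · rw [show (m : ℤ) + b * p + 1 = ((m + 1 : ℕ) : ℤ) + b * p by push_cast; ring,
      colExt_val n b hb c _ h]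
    have := hc.1 m h
    linarith
  · have hmb : (b : ℤ) = m + 1 := by omega
    rw [show (m : ℤ) + b * p + 1 = ((0 : ℕ) : ℤ) + b * (p + 1) by rw [hmb]; push_cast; ring,
      colExt_val n b hb c _ (by omega)]
    have h1 := hc.2 m hm
    have h2 := hc.2 0 (by omega)
    linarith

theorem pair_iff (n b : ℕ) (hb : 1 ≤ b) (c d : ℕ → ℤ) (k l : ℤ) :
    (∀ x < b, tauPow n b k c x ≤ tauPow n b l d x) ↔
      ∀ z : ℤ, colExt n b c z ≤ colExt n b d (z + (l - k)) := by
  constructor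
  · intro h z
    obtain ⟨m, hm, p, hz⟩ := exists_rep b hb (z - k)
    have h1 := h m hm
    unfold tauPow at h1
    rw [show z = (m : ℤ) + k + b * p by linarith, colExt_add_mul n b hb,
      show (m : ℤ) + k + b * p + (l - k) = m + l + b * p by ring, colExt_add_mul n b hb]
    linarith
  · intro h x _
    have := h (x + k)
    rwa [show (x : ℤ) + k + (l - k) = x + l by ring] at this

theorem tauPow_zero_of_lt (n b : ℕ) (hb : 1 ≤ b) (c : ℕ → ℤ) (x : ℕ) (hx : x < b) :
    tauPow n b 0 c x = c x := by
  unfold tauPow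
  have := colExt_val n b hb c x hx 0
  simpa using this

theorem off_iff (n b : ℕ) (hb : 1 ≤ b) (c d : ℕ → ℤ) (hc : GoodCol n b c)
    (hd : GoodCol n b d) (k l : ℤ) :
    (∀ x < b, tauPow n b k c x ≤ tauPow n b l d x) ↔
      k + ((sInf {r : ℕ | ∀ x < b, c x ≤ tauPow n b ((r : ℤ)) d x} : ℕ) : ℤ) ≤ l := by
  have key : ∀ r : ℕ, (∀ x < b, c x ≤ tauPow n b (r : ℤ) d x) ↔
      ∀ z : ℤ, colExt n b c z ≤ colExt n b d (z + r) := by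
    intro r
    have := pair_iff n b hb c d 0 r
    rw [sub_zero] at this
    rw [← this]
    refine forall_congr' fun x => forall_congr' fun hx => ?_
    rw [tauPow_zero_of_lt n b hb c x hx]
  have hmono := colExt_strictMono n b hb d hd
  have hne : {r : ℕ | ∀ x < b, c x ≤ tauPow n b ((r : ℤ)) d x}.Nonempty := by
    refine ⟨b, fun x hx => ?_⟩
    unfold tauPow
    have := colExt_val n b hb d x hx 1
    rw [mul_one] at this
    rw [this]
    have h1 := hc.2 x hx
    have h2 := hd.2 x hx
    linarith
  rw [pair_iff n b hb]
  constructor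
  · intro h
    have hnn : 0 ≤ l - k := by
      by_contra hlt
      have h0 := h 0
      have h1 : colExt n b d (0 + (l - k)) ≤ colExt n b d (-1) := hmono.monotone (by omega)
      have h2 := colExt_val n b hb c 0 (by omega) 0
      have h3 := colExt_val n b hb d (b - 1) (by omega) (-1)
      rw [show ((b - 1 : ℕ) : ℤ) + b * (-1) = -1 by push_cast [hb]; ring] at h3
      simp only [Nat.cast_zero, mul_zero, add_zero] at h2
      have h4 := hc.2 0 (by omega)
      have h5 := hd.2 (b - 1) (by omega)
      linarith
    have : sInf {r : ℕ | ∀ x < b, c x ≤ tauPow n b ((r : ℤ)) d x} ≤ (l - k).toNat := by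
      apply Nat.sInf_le
      rw [Set.mem_setOf_eq, key, Int.toNat_of_nonneg hnn]
      exact h
    omega
  · intro h z
    have h1 := (key _).1 (Nat.sInf_mem hne) z
    exact h1.trans (hmono.monotone (by linarith))

/-- For `T ∈ CSST_[n](R)` (`R = (a^b)`, columns indexed
`0`-based from the right) with symmetrized offset vector `η`, and
`α = (α₁, …, α_a) ∈ ℤ^a` (column `j` from the right receives the exponent
`α_{j+1}`), the shifted filling `τ_n^{α_rev}(T)` lies in `B_n(R)` if and only
if `α_a ≤ α_{a-1} - η_{a-1} ≤ ⋯ ≤ α₁ - η₁`. -/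
theorem tau_shift_in_B_iff (n a b : ℕ) (hn : 0 < n)
    (ha : 1 ≤ a) (hb : 1 ≤ b) (hbn : b ≤ n)
    (T : ℕ → ℕ → ℤ)
    (hcol : ∀ j < a, ∀ x : ℕ, x + 1 < b → T j x < T j (x + 1))
    (hent : ∀ j < a, ∀ x < b, 1 ≤ T j x ∧ T j x ≤ (n : ℤ))
    (α : ℕ → ℤ) :
    ((∀ j : ℕ, j + 1 < a → ∀ x < b,
        tauPow n b (α (j + 2)) (fun y => T (j + 1) y) x ≤
          tauPow n b (α (j + 1)) (fun y => T j y) x) ∧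
     (∀ j < a, ∀ x : ℕ, x + 1 < b →
        tauPow n b (α (j + 1)) (fun y => T j y) x <
          tauPow n b (α (j + 1)) (fun y => T j y) (x + 1)) ∧
     ∀ j < a,
        tauPow n b (α (j + 1)) (fun y => T j y) (b - 1) -
          tauPow n b (α (j + 1)) (fun y => T j y) 0 < (n : ℤ)) ↔
    ((1 < a → α a ≤ α (a - 1) - (etaR n a b T (a - 1) : ℤ)) ∧
     ∀ j : ℕ, 1 ≤ j → j + 1 < a →
        α (j + 1) - (etaR n a b T (j + 1) : ℤ) ≤ α j - (etaR n a b T j : ℤ)) := by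
  have good : ∀ j < a, GoodCol n b (T j) := fun j hj => ⟨hcol j hj, hent j hj⟩
  have hE : ∀ j : ℕ, j + 1 < a →
      (etaR n a b T (j + 1) : ℤ) = rOffR n b T (j + 1) + etaR n a b T (j + 2) := by
    intro j hj
    unfold etaR
    rw [← Finset.insert_Icc_add_one_left_eq_Icc (show j + 1 ≤ a - 1 by omega),
      Finset.sum_insert (by simp)]
    push_cast
    rfl
  have hE0 : etaR n a b T a = 0 := by
    unfold etaR
    rw [Finset.Icc_eq_empty (by omega), Finset.sum_empty]
  have main : ∀ j : ℕ, j + 1 < a → ((∀ x < b,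
      tauPow n b (α (j + 2)) (fun y => T (j + 1) y) x ≤
          tauPow n b (α (j + 1)) (fun y => T j y) x) ↔
      α (j + 2) - (etaR n a b T (j + 2) : ℤ) ≤ α (j + 1) - (etaR n a b T (j + 1) : ℤ)) := by
    intro j hj
    have h := off_iff n b hb (T (j + 1)) (T j) (good _ hj) (good _ (by omega))
      (α (j + 2)) (α (j + 1))
    refine h.trans ?_
    change α (j + 2) + ((rOffR n b T (j + 1) : ℕ) : ℤ) ≤ _ ↔ _
    rw [hE j hj]
    constructor <;> intro h <;> linarith
  constructor
  · rintro ⟨h, -, -⟩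
    constructor
    · intro h1
      obtain ⟨i, rfl⟩ : ∃ i, a = i + 2 := ⟨a - 2, by omega⟩
      have := (main i (by omega)).1 (h i (by omega))
      rw [hE0] at this
      simpa using this
    · intro j h1 h2
      obtain ⟨i, rfl⟩ : ∃ i, j = i + 1 := ⟨j - 1, by omega⟩
      exact (main i (by omega)).1 (h i (by omega))
  · rintro ⟨h1, h2⟩
    refine ⟨fun j hj => (main j hj).2 ?_, fun j hj x hx => ?_, fun j hj => ?_⟩
    · by_cases hja : j + 2 = a
      · subst hja
        rw [hE0]
        simpa using h1 (by omega)
      · exact h2 (j + 1) (by omega) (by omega)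
    · exact colExt_strictMono n b hb _ (good j hj) (by push_cast; linarith)
    · unfold tauPow
      have e := colExt_add_mul n b hb (T j) (((0 : ℕ) : ℤ) + α (j + 1)) 1
      have l : colExt n b (T j) (((b - 1 : ℕ) : ℤ) + α (j + 1)) <
          colExt n b (T j) (((0 : ℕ) : ℤ) + α (j + 1) + b * 1) :=
        colExt_strictMono n b hb _ (good j hj) (by push_cast [hb]; linarith)
      linarith

end AffineRSK
end

section
/- Let n ≥ 2, let A ∈ M̂_{m×n} be nonzero, let j be a column index, and suppose Ã := f̃^t_j A ≠ 0, say Ã = A − Ê_{u,j} + Ê_{u,j+1}. (1) For every proper numbering d on A, with z_k(d) the zig-zag at level k associated to d and s := d(u,j), there exists a proper numbering d⁻ on Ã such that d⁻(c) = d(c) for all c ∈ supp(A) ∩ supp(Ã), and d⁻(u, j+1) = d(u,j) if u is the minimal row index i with (i,j) ∈ z_s(d), and d⁻(u,j+1) = d(u,j) + 1 otherwise. (2) For every proper numbering d on Ã, with t := d(u, j+1), there exists a proper numbering d⁺ on A such that d⁺(c) = d(c) for all c ∈ supp(A) ∩ supp(Ã), and d⁺(u, j) = t − 1 if (u,j)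 ∈ z_{t−1}(d), and d⁺(u,j) = t otherwise. In particular, A and Ã have the same width. -/
open scoped Classical

namespace AffineRSK

/-! ### Transfer of numberings along supports -/

def PropS (S : Set Cell) (d : Cell → ℤ) : Prop :=
  (∀ c₁ ∈ S, ∀ c₂ ∈ S, NW c₂ c₁ → d c₂ < d c₁) ∧
    ∀ c₁ ∈ S, ∃ c₂ ∈ S, NW c₂ c₁ ∧ d c₂ = d c₁ - 1

structure Setup (S T : Set Cell) (U J : ℤ → ℤ) : Prop where
  mono : ∀ k k', k < k' → U k < U k' ∧ J k + 1 < J k'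
  hp : ∀ k, ((U k, J k) : Cell) ∈ S
  hq : ∀ k, ((U k, J k + 1) : Cell) ∈ T
  hST : ∀ c ∈ S, c ∉ T → ∃ k, c = (U k, J k)
  hTS : ∀ c ∈ T, c ∉ S → ∃ k, c = (U k, J k + 1)
  hR : ∀ k i, U k < i → ((i, J k + 1) : Cell) ∈ S →
    ∃ i', U k ≤ i' ∧ i' < i ∧ ((i', J k) : Cell) ∈ T
  hL : ∀ k i, i < U k → ((i, J k) : Cell) ∈ S →
    ∃ i', i < i' ∧ i' ≤ U k ∧ ((i', J k + 1) : Cell) ∈ S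

theorem PropS.le {S : Set Cell} {d : Cell → ℤ} (hd : PropS S d) {c c' : Cell}
    (hc : c ∈ S) (hc' : c' ∈ S) (h : nwGe c c') : d c ≤ d c' := by
  obtain ⟨r, hr, hn, hv⟩ := hd.2 c hc
  have := hd.1 c' hc' r hr ⟨lt_of_lt_of_le hn.1 h.1, lt_of_lt_of_le hn.2 h.2⟩
  omega

section
variable {S T : Set Cell} {U J : ℤ → ℤ}

theorem Setup.J_inj (H : Setup S T U J) {k k' : ℤ} (h : J k = J k') : k = k' := by
  rcases lt_trichotomy k k' with h1 | h1 | h1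
  · have := (H.mono _ _ h1).2; omega
  · exact h1
  · have := (H.mono _ _ h1).2; omega

theorem Setup.J_ne (H : Setup S T U J) (k k' : ℤ) : J k ≠ J k' + 1 := by
  intro h
  rcases lt_trichotomy k k' with h1 | h1 | h1
  · have := (H.mono _ _ h1).2; omega
  · subst h1; omega
  · have := (H.mono _ _ h1).2; omega

theorem Setup.J_lt (H : Setup S T U J) {k k' : ℤ} (h : J k < J k') : k < k' := by
  rcases lt_trichotomy k k' with h1 | h1 | h1
  · exact h1
  · subst h1; omega
  · have := (H.mono _ _ h1).2; omega

/-- membership in column `J k` off row `U k` agrees -/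
theorem Setup.colJ (H : Setup S T U J) {k i : ℤ} (h : i ≠ U k) :
    ((i, J k) : Cell) ∈ S ↔ ((i, J k) : Cell) ∈ T := by
  constructor
  · intro hs
    by_contra ht
    obtain ⟨k', hk'⟩ := H.hST _ hs ht
    have h1 := congrArg Prod.fst hk'
    have h2 := congrArg Prod.snd hk'
    have := H.J_inj h2
    subst this
    exact h h1
  · intro hs
    by_contra ht
    obtain ⟨k', hk'⟩ := H.hTS _ hs ht
    exact H.J_ne _ _ (congrArg Prod.snd hk')

theorem Setup.colJ1 (H : Setup S T U J) {k i : ℤ} (h : i ≠ U k) :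
    ((i, J k + 1) : Cell) ∈ S ↔ ((i, J k + 1) : Cell) ∈ T := by
  constructor
  · intro hs
    by_contra ht
    obtain ⟨k', hk'⟩ := H.hST _ hs ht
    exact H.J_ne _ _ (congrArg Prod.snd hk').symm
  · intro hs
    by_contra ht
    obtain ⟨k', hk'⟩ := H.hTS _ hs ht
    have h1 := congrArg Prod.fst hk'
    have h2 : J k + 1 = J k' + 1 := congrArg Prod.snd hk'
    have := H.J_inj (k := k) (k' := k') (by omega)
    subst this
    exact h h1

def Q1 (S : Set Cell) (U J : ℤ → ℤ) (d : Cell → ℤ) (k : ℤ) : Prop :=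
  ∃ i < U k, ((i, J k) : Cell) ∈ S ∧ d (i, J k) = d (U k, J k)

noncomputable def E1 (S : Set Cell) (U J : ℤ → ℤ) (d : Cell → ℤ) (k : ℤ) : ℤ :=
  if Q1 S U J d k then d (U k, J k) + 1 else d (U k, J k)

theorem part1 (H : Setup S T U J) {d : Cell → ℤ} (hd : PropS S d) :
    ∃ dm : Cell → ℤ, PropS T dm ∧ (∀ c ∈ S ∩ T, dm c = d c) ∧
      ∀ k, dm (U k, J k + 1) = E1 S U J d k := by
  have hge : ∀ k, d (U k, J k) ≤ E1 S U J d k := by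
    intro k; unfold E1; split_ifs <;> omega
  -- upper
  have hup : ∀ k, ∀ x ∈ S, NW x (U k, J k + 1) → d x < E1 S U J d k := by
    intro k x hx hn
    have hn1 : x.1 < U k := hn.1
    have hn2 : x.2 < J k + 1 := hn.2
    by_cases hc : x.2 < J k
    · exact lt_of_lt_of_le (hd.1 _ (H.hp k) x hx ⟨hn1, hc⟩) (hge k)
    · have hxe : x = (x.1, J k) := Prod.ext rfl (by show x.2 = J k; omega)
      have hle : d x ≤ d (U k, J k) := hd.le hx (H.hp k) ⟨by show x.1 ≤ U k; omega, by show x.2 ≤ J k; omega⟩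
      unfold E1
      split_ifs with hQ
      · omega
      · rcases lt_or_eq_of_le hle with h | h
        · exact h
        · exact absurd ⟨x.1, hn1, hxe ▸ hx, hxe ▸ h⟩ hQ
  -- predecessor of q
  have hpred : ∀ k, ∃ x ∈ S, NW x (U k, J k + 1) ∧ d x = E1 S U J d k - 1 := by
    intro k
    unfold E1
    split_ifs with hQ
    · obtain ⟨i, hi, hiS, hv⟩ := hQ
      exact ⟨(i, J k), hiS, ⟨hi, by show J k < J k + 1; omega⟩, by omega⟩
    · obtain ⟨r, hr, hn, hv⟩ := hd.2 _ (H.hp k)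
      exact ⟨r, hr, ⟨hn.1, by have : r.2 < J k := hn.2
                              show r.2 < J k + 1; omega⟩, hv⟩
  -- lower
  have hlow : ∀ k, ∀ x ∈ S, NW (U k, J k + 1) x → E1 S U J d k < d x := by
    intro k x hx hn
    have hn1 : U k < x.1 := hn.1
    have hn2 : J k + 1 < x.2 := hn.2
    unfold E1
    split_ifs with hQ
    · obtain ⟨i, hi, hiS, hv⟩ := hQ
      obtain ⟨i', h1, h2, h3⟩ := H.hL k i hi hiS
      have a1 := hd.1 _ h3 _ hiS ⟨h1, by show J k < J k + 1; omega⟩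
      have a2 := hd.1 _ hx _ h3 ⟨by show i' < x.1; omega, hn2⟩
      omega
    · exact hd.1 _ hx _ (H.hp k) ⟨hn1, by show J k < x.2; omega⟩
  let dm : Cell → ℤ := fun c =>
    if h : ∃ k, c = (U k, J k + 1) then E1 S U J d h.choose else d c
  have hdq : ∀ k, dm (U k, J k + 1) = E1 S U J d k := by
    intro k
    have h : ∃ k', ((U k, J k + 1) : Cell) = (U k', J k' + 1) := ⟨k, rfl⟩
    have e : dm (U k, J k + 1) = E1 S U J d h.choose := dif_pos h
    have h2 : J k + 1 = J h.choose + 1 := congrArg Prod.snd h.choose_spec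
    have := H.J_inj (k := k) (k' := h.choose) (by omega)
    rw [e, ← this]
  have hagree : ∀ k, ((U k, J k + 1) : Cell) ∈ S → d (U k, J k + 1) = E1 S U J d k := by
    intro k hk
    obtain ⟨r, hr, hn, hv⟩ := hd.2 _ hk
    have a1 := hup k r hr hn
    obtain ⟨x, hx, hn', hv'⟩ := hpred k
    have a2 := hd.1 _ hk x hx hn'
    omega
  have hdS : ∀ c ∈ S, dm c = d c := by
    intro c hc
    by_cases h : ∃ k, c = (U k, J k + 1)
    · obtain ⟨k, rfl⟩ := h
      rw [hdq, hagree k hc]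
    · exact dif_neg h
  refine ⟨dm, ⟨?_, ?_⟩, fun c hc => hdS c hc.1, hdq⟩
  · have X : ∀ c₁ ∈ S, ∀ c₂ ∈ T, NW c₂ c₁ → dm c₂ < d c₁ := by
      intro c₁ h1 c₂ h2 hn
      by_cases h : c₂ ∈ S
      · rw [hdS _ h]; exact hd.1 _ h1 _ h hn
      · obtain ⟨k, rfl⟩ := H.hTS _ h2 h
        rw [hdq]; exact hlow k _ h1 hn
    intro c₁ h1 c₂ h2 hn
    by_cases h : c₁ ∈ S
    · rw [hdS c₁ h]; exact X _ h _ h2 hn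
    · obtain ⟨k', rfl⟩ := H.hTS _ h1 h
      rw [hdq]
      by_cases h' : c₂ ∈ S
      · rw [hdS _ h']; exact hup k' _ h' hn
      · obtain ⟨k, rfl⟩ := H.hTS _ h2 h'
        have hn1 : U k < U k' := hn.1
        have hn2 : J k + 1 < J k' + 1 := hn.2
        have hk := H.mono _ _ (H.J_lt (k := k) (k' := k') (by omega))
        exact lt_of_lt_of_le (X _ (H.hp k') _ h2 ⟨hn1, hk.2⟩) (hge k')
  · intro c hc
    have h0 : ∃ x ∈ S, NW x c ∧ d x = dm c - 1 := by
      by_cases h : c ∈ S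
      · rw [hdS c h]; exact hd.2 c h
      · obtain ⟨k, rfl⟩ := H.hTS _ hc h
        rw [hdq]; exact hpred k
    obtain ⟨x, hx, hn, hv⟩ := h0
    by_cases hxT : x ∈ T
    · exact ⟨x, hxT, hn, by rw [hdS x hx, hv]⟩
    obtain ⟨k, rfl⟩ := H.hST _ hx hxT
    have hn1 : U k < c.1 := hn.1
    have hn2 : J k < c.2 := hn.2
    by_cases hQ : Q1 S U J d k
    · obtain ⟨i, hi, hiS, hiv⟩ := hQ
      refine ⟨(i, J k), (H.colJ (by omega)).1 hiS, ⟨by show i < c.1; omega, hn2⟩, ?_⟩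
      rw [hdS _ hiS, hiv, hv]
    · by_cases hc2 : J k + 1 < c.2
      · refine ⟨(U k, J k + 1), H.hq k, ⟨hn1, hc2⟩, ?_⟩
        rw [hdq, E1, if_neg hQ, hv]
      · have hce : c = (c.1, J k + 1) := Prod.ext rfl (by show c.2 = J k + 1; omega)
        have hcS : ((c.1, J k + 1) : Cell) ∈ S := (H.colJ1 (by omega)).2 (hce ▸ hc)
        obtain ⟨i', h1, h2, h3⟩ := H.hR k c.1 hn1 hcS
        have hne : i' ≠ U k := by
          rintro rfl; exact hxT h3
        have h3S := (H.colJ hne).2 h3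
        refine ⟨(i', J k), h3, ⟨h2, hn2⟩, ?_⟩
        rw [hdS _ h3S]
        rw [← hce] at hcS
        have a1 := hd.le (H.hp k) h3S ⟨h1, le_refl _⟩
        have a2 := hd.1 c hcS _ h3S ⟨h2, hn2⟩
        rw [hdS c hcS] at hv ⊢
        omega

def Q2 (T : Set Cell) (U J : ℤ → ℤ) (d : Cell → ℤ) (k : ℤ) : Prop :=
  ∃ r ∈ T, NW r (U k, J k) ∧ d r = d (U k, J k + 1) - 1

noncomputable def E2 (T : Set Cell) (U J : ℤ → ℤ) (d : Cell → ℤ) (k : ℤ) : ℤ :=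
  if Q2 T U J d k then d (U k, J k + 1) else d (U k, J k + 1) - 1

theorem notQ2 (H : Setup S T U J) {d : Cell → ℤ} (hd : PropS T d) {k : ℤ}
    (hQ : ¬ Q2 T U J d k) :
    ∃ i < U k, ((i, J k) : Cell) ∈ T ∧ d (i, J k) = d (U k, J k + 1) - 1 := by
  obtain ⟨r, hr, hn, hv⟩ := hd.2 _ (H.hq k)
  have hn1 : r.1 < U k := hn.1
  have hn2 : r.2 < J k + 1 := hn.2
  by_cases hc : r.2 < J k
  · exact absurd ⟨r, hr, ⟨hn1, hc⟩, hv⟩ hQ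
  · have hre : r = (r.1, J k) := Prod.ext rfl (by show r.2 = J k; omega)
    exact ⟨r.1, hn1, hre ▸ hr, hre ▸ hv⟩

theorem part2 (H : Setup S T U J) {d : Cell → ℤ} (hd : PropS T d) :
    ∃ dp : Cell → ℤ, PropS S dp ∧ (∀ c ∈ S ∩ T, dp c = d c) ∧
      ∀ k, dp (U k, J k) = E2 T U J d k := by
  have hle : ∀ k, E2 T U J d k ≤ d (U k, J k + 1) := by
    intro k; unfold E2; split_ifs <;> omega
  have hup : ∀ k, ∀ x ∈ T, NW x (U k, J k) → d x < E2 T U J d k := by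
    intro k x hx hn
    have hn1 : x.1 < U k := hn.1
    have hn2 : x.2 < J k := hn.2
    have a := hd.1 _ (H.hq k) x hx ⟨hn1, by show x.2 < J k + 1; omega⟩
    unfold E2
    split_ifs with hQ
    · exact a
    · have : d x ≠ d (U k, J k + 1) - 1 := fun h => hQ ⟨x, hx, hn, h⟩
      omega
  have hpred : ∀ k, ∃ x ∈ T, NW x (U k, J k) ∧ d x = E2 T U J d k - 1 := by
    intro k
    unfold E2
    split_ifs with hQ
    · exact hQ
    · obtain ⟨i, hi, hiT, hv⟩ := notQ2 H hd hQ
      obtain ⟨r, hr, hn, hv'⟩ := hd.2 _ hiT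
      refine ⟨r, hr, ⟨lt_trans hn.1 hi, hn.2⟩, by omega⟩
  have hlow : ∀ k, ∀ x ∈ T, NW (U k, J k) x → E2 T U J d k < d x := by
    intro k x hx hn
    have hn1 : U k < x.1 := hn.1
    have hn2 : J k < x.2 := hn.2
    by_cases hc : J k + 1 < x.2
    · exact lt_of_le_of_lt (hle k) (hd.1 _ hx _ (H.hq k) ⟨hn1, hc⟩)
    · have hxe : x = (x.1, J k + 1) := Prod.ext rfl (by show x.2 = J k + 1; omega)
      have hxT : ((x.1, J k + 1) : Cell) ∈ T := hxe ▸ hx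
      obtain ⟨i', h1, h2, h3⟩ := H.hR k x.1 hn1 ((H.colJ1 (by omega)).2 hxT)
      -- d (i', J k) ≥ E2
      obtain ⟨y, hy, hny, hvy⟩ := hpred k
      have a1 := hd.1 _ h3 y hy ⟨lt_of_lt_of_le hny.1 h1, hny.2⟩
      have a2 := hd.1 _ hx _ h3 ⟨h2, hn2⟩
      omega
  let dp : Cell → ℤ := fun c =>
    if h : ∃ k, c = (U k, J k) then E2 T U J d h.choose else d c
  have hdp : ∀ k, dp (U k, J k) = E2 T U J d k := by
    intro k
    have h : ∃ k', ((U k, J k) : Cell) = (U k', J k') := ⟨k, rfl⟩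
    have e : dp (U k, J k) = E2 T U J d h.choose := dif_pos h
    have h2 : J k = J h.choose := congrArg Prod.snd h.choose_spec
    have := H.J_inj h2
    rw [e, ← this]
  have hagree : ∀ k, ((U k, J k) : Cell) ∈ T → d (U k, J k) = E2 T U J d k := by
    intro k hk
    obtain ⟨r, hr, hn, hv⟩ := hd.2 _ hk
    have a1 := hup k r hr hn
    obtain ⟨x, hx, hn', hv'⟩ := hpred k
    have a2 := hd.1 _ hk x hx hn'
    omega
  have hdT : ∀ c ∈ T, dp c = d c := by
    intro c hc
    by_cases h : ∃ k, c = (U k, J k)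
    · obtain ⟨k, rfl⟩ := h
      rw [hdp, hagree k hc]
    · exact dif_neg h
  refine ⟨dp, ⟨?_, ?_⟩, fun c hc => hdT c hc.2, hdp⟩
  · intro c₁ h1 c₂ h2 hn
    by_cases h : c₁ ∈ T
    · rw [hdT c₁ h]
      by_cases h' : c₂ ∈ T
      · rw [hdT _ h']; exact hd.1 _ h _ h' hn
      · obtain ⟨k, rfl⟩ := H.hST _ h2 h'
        rw [hdp]; exact hlow k _ h hn
    · obtain ⟨k', rfl⟩ := H.hST _ h1 h
      rw [hdp]
      by_cases h' : c₂ ∈ T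
      · rw [hdT _ h']; exact hup k' _ h' hn
      · obtain ⟨k, rfl⟩ := H.hST _ h2 h'
        rw [hdp]
        have hn1 : U k < U k' := hn.1
        have hk := H.mono _ _ (H.J_lt (k := k) (k' := k') hn.2)
        exact lt_of_le_of_lt (hle k) (hup k' _ (H.hq k) ⟨hn1, hk.2⟩)
  · intro c hc
    have h0 : ∃ x ∈ T, NW x c ∧ d x = dp c - 1 := by
      by_cases h : c ∈ T
      · rw [hdT c h]; exact hd.2 c h
      · obtain ⟨k, rfl⟩ := H.hST _ hc h
        rw [hdp]; exact hpred k
    obtain ⟨x, hx, hn, hv⟩ := h0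
    by_cases hxS : x ∈ S
    · exact ⟨x, hxS, hn, by rw [hdT x hx, hv]⟩
    obtain ⟨k, rfl⟩ := H.hTS _ hx hxS
    have hn1 : U k < c.1 := hn.1
    have hn2 : J k + 1 < c.2 := hn.2
    by_cases hQ : Q2 T U J d k
    · refine ⟨(U k, J k), H.hp k, ⟨hn1, by show J k < c.2; omega⟩, ?_⟩
      rw [hdp, E2, if_pos hQ, hv]
    · obtain ⟨i, hi, hiT, hiv⟩ := notQ2 H hd hQ
      obtain ⟨i', h1, h2, h3⟩ := H.hL k i hi ((H.colJ (by omega)).2 hiT)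
      have hne : i' ≠ U k := by
        rintro rfl; exact hxS h3
      have h3T := (H.colJ1 hne).1 h3
      refine ⟨(i', J k + 1), h3, ⟨by show i' < c.1; omega, hn2⟩, ?_⟩
      rw [hdT _ h3T]
      have a1 := hd.1 _ h3T _ hiT ⟨h1, by show J k < J k + 1; omega⟩
      have a2 := hd.le h3T (H.hq k) ⟨h2, le_refl _⟩
      omega

end

/-! ### Zig-zags -/

theorem zz_diag {z : ℤ → Cell} (hz : IsZigZag z) (i : ℤ) :
    (z i).2 - (z i).1 = (z 0).2 - (z 0).1 + i := by
  have hs : ∀ i, (z (i + 1)).2 - (z (i + 1)).1 = (z i).2 - (z i).1 + 1 := by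
    intro i
    rcases hz.1 i with h | h <;> rw [h] <;> dsimp only <;> omega
  induction i using Int.induction_on with
  | zero => omega
  | succ k ih => have := hs k; omega
  | pred k ih =>
    have := hs (-(k : ℤ) - 1)
    rw [show (-(k : ℤ) - 1 + 1) = -(k : ℤ) by omega] at this
    omega

theorem zz_mono {z : ℤ → Cell} (hz : IsZigZag z) (i : ℤ) (k : ℕ) :
    (z (i + k)).1 ≤ (z i).1 ∧ (z i).2 ≤ (z (i + k)).2 := by
  induction k with
  | zero => simp
  | succ k ih =>
    have e : i + ((k + 1 : ℕ) : ℤ) = i + k + 1 := by push_cast; omega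
    rw [e]
    rcases hz.1 (i + k) with h | h <;> rw [h] <;> dsimp only <;> omega

theorem zz_notNW {z : ℤ → Cell} (hz : IsZigZag z) (i k : ℤ) : ¬ NW (z i) (z k) := by
  rintro ⟨h1, h2⟩
  rcases le_total i k with h | h
  · obtain ⟨a, rfl⟩ := Int.le.dest h
    have := zz_mono hz i a; omega
  · obtain ⟨a, rfl⟩ := Int.le.dest h
    have := zz_mono hz k a; omega

theorem zz_corner {z : ℤ → Cell} (hz : IsZigZag z) (i : ℤ) :
    ∃ r ∈ innerCorners z, nwGe r (z i) := by
  obtain ⟨hs, ⟨N, hN⟩, ⟨M, hM⟩⟩ := hz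
  by_cases hE : z (i + 1) = ((z i).1, (z i).2 + 1)
  · -- go back while the steps are east
    have hex : ∃ a : ℕ, z (i - a) = ((z (i - a - 1)).1 - 1, (z (i - a - 1)).2) := by
      refine ⟨(i - M).toNat, ?_⟩
      have := hM (i - ((i - M).toNat : ℤ) - 1) (by omega)
      rw [sub_add_cancel] at this
      exact this
    have hmin := fun b => Nat.find_min hex (m := b)
    have hsp := Nat.find_spec hex
    generalize Nat.find hex = a at hmin hsp
    -- steps between are east
    have hst : ∀ b : ℕ, b < a → z (i - b) = ((z (i - b - 1)).1, (z (i - b - 1)).2 + 1) := by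
      intro b hb
      have := hs (i - b - 1)
      rw [sub_add_cancel] at this
      exact this.resolve_right (hmin b hb)
    have hpos : ∀ b : ℕ, b ≤ a → (z (i - b)).1 = (z i).1 ∧ (z (i - b)).2 ≤ (z i).2 := by
      intro b
      induction b with
      | zero => intro _; simp
      | succ b ih =>
        intro hb
        have h1 := ih (by omega)
        have h2 := hst b (by omega)
        have e : i - ((b + 1 : ℕ) : ℤ) = i - b - 1 := by push_cast; omega
        rw [e]
        have h3 := congrArg Prod.fst h2
        have h4 := congrArg Prod.snd h2
        dsimp only at h3 h4
        omega
    refine ⟨z (i - a), ⟨i - a, rfl, hsp, ?_⟩, ⟨(hpos a le_rfl).1.le, (hpos a le_rfl).2⟩⟩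
    rcases Nat.eq_zero_or_pos a with h0 | h0
    · subst h0; simpa using hE
    · have h2 := hst (a - 1) (by omega)
      have e1 : i - ((a - 1 : ℕ) : ℤ) = i - a + 1 := by omega
      rw [e1, add_sub_cancel_right] at h2
      exact h2
  · have hex : ∃ a : ℕ, z (i + a + 1) = ((z (i + a)).1, (z (i + a)).2 + 1) := by
      exact ⟨(N - i).toNat, hN _ (by omega)⟩
    have hmin := fun b => Nat.find_min hex (m := b)
    have hsp := Nat.find_spec hex
    generalize Nat.find hex = a at hmin hsp
    have hst : ∀ b : ℕ, b < a → z (i + b + 1) = ((z (i + b)).1 - 1, (z (i + b)).2) := by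
      intro b hb
      exact (hs (i + b)).resolve_left (hmin b hb)
    have hpos : ∀ b : ℕ, b ≤ a → (z (i + b)).1 ≤ (z i).1 ∧ (z (i + b)).2 = (z i).2 := by
      intro b
      induction b with
      | zero => intro _; simp
      | succ b ih =>
        intro hb
        have h1 := ih (by omega)
        have h2 := hst b (by omega)
        have e : i + ((b + 1 : ℕ) : ℤ) = i + b + 1 := by push_cast; omega
        rw [e, h2]
        dsimp only
        omega
    have h0 : a ≠ 0 := by
      rintro rfl; apply hE; simpa using hsp
    refine ⟨z (i + a), ⟨i + a, rfl, ?_, hsp⟩, ⟨(hpos a le_rfl).1, (hpos a le_rfl).2.le⟩⟩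
    have h2 := hst (a - 1) (by omega)
    have e1 : i + ((a - 1 : ℕ) : ℤ) = i + a - 1 := by omega
    rw [e1, sub_add_cancel] at h2
    exact h2

theorem exists_maximal {L : Set Cell} (hL : L.Finite) {r : Cell} (hr : r ∈ L) :
    ∃ r' ∈ nwMaximal L, nwGe r' r := by
  have hf : {x ∈ L | nwGe x r}.Finite := hL.subset (fun x hx => hx.1)
  obtain ⟨a, ha, hmin⟩ := Set.exists_min_image _ (fun x : Cell => x.1 + x.2) hf
    ⟨r, hr, le_refl _, le_refl _⟩
  refine ⟨a, ⟨ha.1, ?_⟩, ha.2⟩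
  intro c hc hca
  have := hmin c ⟨hc, le_trans hca.1 ha.2.1, le_trans hca.2 ha.2.2⟩
  obtain ⟨h1, h2⟩ := hca
  exact Prod.ext (by omega) (by omega)

theorem zz_range {L : Set Cell} (hL : L.Finite) {z : ℤ → Cell} (hz : IsZigZag z)
    (hc : innerCorners z = nwMaximal L) (x : Cell) :
    x ∈ Set.range z ↔ (∃ r ∈ L, nwGe r x) ∧ ¬ ∃ r ∈ L, NW r x := by
  have hin : ∀ r ∈ L, ∃ i, nwGe (z i) r := by
    intro r hr
    obtain ⟨r', hr', h⟩ := exists_maximal hL hr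
    rw [← hc] at hr'
    obtain ⟨i, hi, -⟩ := hr'
    exact ⟨i, hi ▸ h⟩
  have hcor : ∀ i, ∃ r ∈ L, nwGe r (z i) := by
    intro i
    obtain ⟨r, hr, h⟩ := zz_corner hz i
    rw [hc] at hr
    exact ⟨r, hr.1, h⟩
  constructor
  · rintro ⟨i, rfl⟩
    refine ⟨hcor i, ?_⟩
    rintro ⟨r, hr, h⟩
    obtain ⟨k, hk⟩ := hin r hr
    exact zz_notNW hz k i ⟨lt_of_le_of_lt hk.1 h.1, lt_of_le_of_lt hk.2 h.2⟩
  · rintro ⟨⟨r, hr, hrx⟩, hno⟩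
    obtain ⟨i, hi⟩ : ∃ i, (z i).2 - (z i).1 = x.2 - x.1 :=
      ⟨x.2 - x.1 - ((z 0).2 - (z 0).1), by rw [zz_diag hz]; omega⟩
    refine ⟨i, ?_⟩
    rcases lt_trichotomy (z i).1 x.1 with h | h | h
    · exfalso
      obtain ⟨r', hr', h'⟩ := hcor i
      exact hno ⟨r', hr', lt_of_le_of_lt h'.1 h, lt_of_le_of_lt h'.2 (by omega)⟩
    · exact Prod.ext h (by omega)
    · exfalso
      obtain ⟨k, hk⟩ := hin r hr
      refine zz_notNW hz k i ⟨?_, ?_⟩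
      · exact lt_of_le_of_lt (le_trans hk.1 hrx.1) h
      · exact lt_of_le_of_lt (le_trans hk.2 hrx.2) (by omega)

theorem zz_exists {L : Set Cell} (hL : L.Finite) (hne : L.Nonempty) :
    ∃ z, IsZigZag z ∧ innerCorners z = nwMaximal L := by
  have hex : ∀ δ : ℤ, ∃ h : ℤ, (∀ r ∈ L, h ≤ max r.1 (r.2 - δ)) ∧
      ∃ r ∈ L, h = max r.1 (r.2 - δ) := by
    intro δ
    obtain ⟨a, ha, hm⟩ := Set.exists_min_image L (fun r => max r.1 (r.2 - δ)) hL hne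
    exact ⟨_, hm, a, ha, rfl⟩
  choose h hlb hat using hex
  have step : ∀ δ, h (δ + 1) = h δ ∨ h (δ + 1) = h δ - 1 := by
    intro δ
    obtain ⟨r, hr, e⟩ := hat δ
    obtain ⟨r', hr', e'⟩ := hat (δ + 1)
    have h1 := hlb δ r' hr'
    have h2 := hlb (δ + 1) r hr
    omega
  obtain ⟨a1, ha1, hm1⟩ := Set.exists_min_image L (fun r => r.1) hL hne
  obtain ⟨a2, ha2, hm2⟩ := Set.exists_min_image L (fun r => r.2) hL hne
  have hbig : ∀ δ, a1.2 - a1.1 ≤ δ → h δ = a1.1 := by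
    intro δ hδ
    obtain ⟨r, hr, e⟩ := hat δ
    have h1 := hlb δ a1 ha1
    have h2 := hm1 r hr
    omega
  have hsmall : ∀ δ, δ ≤ a2.2 - a2.1 → h δ = a2.2 - δ := by
    intro δ hδ
    obtain ⟨r, hr, e⟩ := hat δ
    have h1 := hlb δ a2 ha2
    have h2 := hm2 r hr
    omega
  refine ⟨fun δ => (h δ, h δ + δ), ⟨?_, ⟨a1.2 - a1.1, ?_⟩, ⟨a2.2 - a2.1 - 1, ?_⟩⟩, ?_⟩
  · intro δ
    rcases step δ with e | e <;> dsimp only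
    · left; rw [e]; exact Prod.ext rfl (by dsimp only; omega)
    · right; rw [e]; exact Prod.ext rfl (by dsimp only; omega)
  · intro δ hδ
    have e1 := hbig δ hδ
    have e2 := hbig (δ + 1) (by omega)
    exact Prod.ext (by dsimp only; omega) (by dsimp only; omega)
  · intro δ hδ
    have e1 := hsmall δ (by omega)
    have e2 := hsmall (δ + 1) (by omega)
    exact Prod.ext (by dsimp only; omega) (by dsimp only; omega)
  · ext c
    constructor
    · rintro ⟨δ, rfl, e1, e2⟩
      have f1 := congrArg Prod.fst e1
      have f2 := congrArg Prod.fst e2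
      dsimp only at f1 f2 ⊢
      have key : ∀ r ∈ L, r.1 ≤ h δ → r.2 - δ ≤ h δ → r = (h δ, h δ + δ) := by
        intro r hr g1 g2
        have k1 := hlb (δ - 1) r hr
        have k2 := hlb (δ + 1) r hr
        exact Prod.ext (by dsimp only; omega) (by dsimp only; omega)
      obtain ⟨r, hr, e⟩ := hat δ
      have hr0 := key r hr (by omega) (by omega)
      refine ⟨hr0 ▸ hr, ?_⟩
      rintro c hc ⟨g1, g2⟩
      dsimp only at g1 g2
      exact key c hc g1 (by omega)
    · rintro ⟨hc, hmax⟩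
      have key : ∀ r ∈ L, r.1 ≤ c.1 → r.2 ≤ c.2 → r = c := fun r hr g1 g2 => hmax r hr ⟨g1, g2⟩
      have key' : ∀ δ, δ = c.2 - c.1 → h δ = c.1 ∧ h (δ - 1) = c.1 + 1 ∧ h (δ + 1) = c.1 := by
        rintro δ rfl
        refine ⟨?_, ?_, ?_⟩
        · have k1 := hlb (c.2 - c.1) c hc
          obtain ⟨r, hr, e⟩ := hat (c.2 - c.1)
          by_contra hne
          have := key r hr (by omega) (by omega)
          subst this; omega
        · have k1 := hlb (c.2 - c.1 - 1) c hc
          obtain ⟨r, hr, e⟩ := hat (c.2 - c.1 - 1)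
          by_contra hne
          have := key r hr (by omega) (by omega)
          subst this; omega
        · have k1 := hlb (c.2 - c.1 + 1) c hc
          obtain ⟨r, hr, e⟩ := hat (c.2 - c.1 + 1)
          by_contra hne
          have := key r hr (by omega) (by omega)
          subst this; omega
      obtain ⟨k1, k2, k3⟩ := key' _ rfl
      exact ⟨c.2 - c.1, Prod.ext (by dsimp only; omega) (by dsimp only; omega),
        Prod.ext (by dsimp only; omega) (by dsimp only; omega),
        Prod.ext (by dsimp only; omega) (by dsimp only; omega)⟩

/-! ### Finiteness and widths -/

theorem gap_zmul {m n : ℕ} {B : Mat} (hB : IsGAP m n B) (i j k : ℤ) :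
    B (i + k * m) (j + k * n) = B i j := by
  induction k using Int.induction_on with
  | zero => simp
  | succ k ih =>
    rw [← ih, ← hB.1 (i + k * m) (j + k * n)]
    congr 1 <;> ring
  | pred k ih =>
    rw [← ih, ← hB.1 (i + (-(k : ℤ) - 1) * m) (j + (-(k : ℤ) - 1) * n)]
    congr 1 <;> ring

theorem gap_bound {m n : ℕ} (hn : 0 < n) {B : Mat} (hB : IsGAP m n B) :
    ∃ K : ℤ, ∀ c ∈ supp B, |(n : ℤ) * c.1 - m * c.2| ≤ K := by
  have hF : {c ∈ supp B | 0 ≤ c.2 ∧ c.2 < n}.Finite := by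
    have : {c ∈ supp B | 0 ≤ c.2 ∧ c.2 < n} ⊆
        ⋃ y ∈ Set.Ico (0 : ℤ) n, (fun i => ((i, y) : Cell)) '' {i : ℤ | B i y ≠ 0} := by
      rintro c ⟨hc, h1, h2⟩
      simp only [Set.mem_iUnion]
      exact ⟨c.2, ⟨h1, h2⟩, c.1, hc, rfl⟩
    refine Set.Finite.subset (Set.Finite.biUnion (Set.finite_Ico _ _) ?_) this
    intro y _
    exact (hB.2 y).image _
  obtain ⟨K, hK⟩ := (hF.image (fun c : Cell => |(n : ℤ) * c.1 - m * c.2|)).bddAbove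
  refine ⟨K, fun c hc => ?_⟩
  have hn' : (0 : ℤ) < n := by exact_mod_cast hn
  have hdm := Int.emod_add_mul_ediv c.2 n
  set q := c.2 / (n : ℤ)
  have hmem : ((c.1 + (-q) * m, c.2 + (-q) * n) : Cell) ∈ {c ∈ supp B | 0 ≤ c.2 ∧ c.2 < n} := by
    refine ⟨?_, ?_, ?_⟩
    · show B _ _ ≠ 0
      dsimp only
      rw [gap_zmul hB]; exact hc
    · have := Int.emod_nonneg c.2 hn'.ne'
      dsimp only; nlinarith
    · have := Int.emod_lt_of_pos c.2 hn'
      dsimp only; nlinarith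
  have := hK ⟨_, hmem, rfl⟩
  dsimp only at this
  rw [show (n : ℤ) * (c.1 + (-q) * m) - m * (c.2 + (-q) * n) = n * c.1 - m * c.2 by ring] at this
  exact this

theorem level_finite {m n : ℕ} (hm : 0 < m) (hn : 0 < n) {B : Mat} (hB : IsGAP m n B)
    {d : Cell → ℤ} (hd : IsProper B d) (k : ℤ) : (levelSet B d k).Finite := by
  rcases Set.eq_empty_or_nonempty (levelSet B d k) with h | ⟨c0, hc0⟩
  · rw [h]; exact Set.finite_empty
  obtain ⟨K, hK⟩ := gap_bound hn hB
  have hm' : (1 : ℤ) ≤ m := by exact_mod_cast hm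
  have hn' : (1 : ℤ) ≤ n := by exact_mod_cast hn
  set M : ℤ := |c0.2| + |(n : ℤ) * c0.1| + |K| with hM
  have hcol : ∀ c ∈ levelSet B d k, c.2 ∈ Set.Icc (-M) M := by
    intro c hc
    have h1 := abs_le.1 (hK c hc.1)
    have a1 := abs_nonneg ((n : ℤ) * c0.1)
    have a2 := abs_nonneg K
    have a3 := abs_nonneg c0.2
    have b1 := neg_abs_le ((n : ℤ) * c0.1)
    have b2 := le_abs_self ((n : ℤ) * c0.1)
    have b3 := le_abs_self K
    have b4 := neg_abs_le c0.2
    have b5 := le_abs_self c0.2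
    have e : d c = d c0 := hc.2.trans hc0.2.symm
    rcases lt_trichotomy c.2 c0.2 with h | h | h
    · have h2 : c0.1 ≤ c.1 := by
        by_contra h2
        have := hd.1 c0 hc0.1 c hc.1 ⟨by omega, h⟩
        omega
      have h3 : (n : ℤ) * c0.1 ≤ n * c.1 := mul_le_mul_of_nonneg_left h2 (by omega)
      refine ⟨?_, by omega⟩
      by_contra h4
      have : (m : ℤ) * c.2 ≤ c.2 := by nlinarith
      omega
    · constructor <;> omega
    · have h2 : c.1 ≤ c0.1 := by
        by_contra h2
        have := hd.1 c hc.1 c0 hc0.1 ⟨by omega, h⟩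
        omega
      have h3 : (n : ℤ) * c.1 ≤ n * c0.1 := mul_le_mul_of_nonneg_left h2 (by omega)
      refine ⟨by omega, ?_⟩
      by_contra h4
      have : c.2 ≤ (m : ℤ) * c.2 := by nlinarith
      omega
  have : levelSet B d k ⊆
      ⋃ y ∈ Set.Icc (-M) M, (fun i => ((i, y) : Cell)) '' {i : ℤ | B i y ≠ 0} := by
    intro c hc
    simp only [Set.mem_iUnion]
    exact ⟨c.2, hcol c hc, c.1, hc.1, rfl⟩
  refine Set.Finite.subset (Set.Finite.biUnion (Set.finite_Icc _ _) ?_) this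
  intro y _
  exact (hB.2 y).image _

theorem width_le {m n : ℕ} (hm : 0 < m) (hn : 0 < n) {B : Mat} (hB : IsGAP m n B)
    (hne : (supp B).Nonempty) {l l' : ℕ} {d d' : Cell → ℤ}
    (hd : IsProper B d) (hl : ∀ c ∈ supp B, d (tauC m n c) = d c + (l : ℤ))
    (hd' : IsProper B d') (hl' : ∀ c ∈ supp B, d' (tauC m n c) = d' c + (l' : ℤ)) :
    l ≤ l' := by
  obtain ⟨K, hK⟩ := gap_bound hn hB
  have hn' : (0 : ℤ) < n := by exact_mod_cast hn
  have hm' : (0 : ℤ) < m := by exact_mod_cast hm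
  have hpred := hd.2
  choose! f hfS hfN hfd using hpred
  obtain ⟨c0, hc0⟩ := hne
  let c : ℕ → Cell := fun a => f^[a] c0
  have hcs : ∀ a, c (a + 1) = f (c a) := fun a => Function.iterate_succ_apply' f a c0
  have hcS : ∀ a, c a ∈ supp B := by
    intro a
    induction a with
    | zero => exact hc0
    | succ a ih => rw [hcs]; exact hfS _ ih
  have hchain : ∀ a b : ℕ, d (c (a + b)) = d (c a) - b ∧ d' (c (a + b)) ≤ d' (c a) - b ∧
      (c (a + b)).2 ≤ (c a).2 - b := by
    intro a b
    induction b with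
    | zero => simp
    | succ b ih =>
      have h1 := hfd _ (hcS (a + b))
      have h2 := hfN _ (hcS (a + b))
      have h3 := hd'.1 _ (hcS (a + b)) _ (hfS _ (hcS (a + b))) h2
      rw [← add_assoc, hcs]
      have h4 := h2.2
      push_cast
      refine ⟨by omega, by omega, by omega⟩
  -- pigeonhole
  obtain ⟨a, b, hab, he⟩ : ∃ a b : ℕ, a < b ∧
      (((c a).2 % (n : ℤ), (n : ℤ) * (c a).1 - m * (c a).2) : ℤ × ℤ) =
      ((c b).2 % (n : ℤ), (n : ℤ) * (c b).1 - m * (c b).2) := by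
    have hmt : Set.MapsTo (fun a : ℕ => (((c a).2 % (n : ℤ), (n : ℤ) * (c a).1 - m * (c a).2) : ℤ × ℤ))
        Set.univ ((Set.Ico (0 : ℤ) n) ×ˢ (Set.Icc (-K) K)) := by
      intro a _
      exact ⟨⟨Int.emod_nonneg _ hn'.ne', Int.emod_lt_of_pos _ hn'⟩, abs_le.1 (hK _ (hcS a))⟩
    obtain ⟨a, -, b, -, hne, he⟩ := Set.infinite_univ.exists_ne_map_eq_of_mapsTo hmt
      ((Set.finite_Ico _ _).prod (Set.finite_Icc _ _))
    rcases lt_or_gt_of_ne hne with h | h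
    · exact ⟨a, b, h, he⟩
    · exact ⟨b, a, h, he.symm⟩
  have he1 : (c a).2 % (n : ℤ) = (c b).2 % (n : ℤ) := congrArg Prod.fst he
  have he2 : (n : ℤ) * (c a).1 - m * (c a).2 = (n : ℤ) * (c b).1 - m * (c b).2 := congrArg Prod.snd he
  obtain ⟨e, rfl⟩ : ∃ e, b = a + e := ⟨b - a, by omega⟩
  obtain ⟨g1, g2, g3⟩ := hchain a e
  obtain ⟨k, hk⟩ := (Int.ModEq.dvd he1.symm :
    (n : ℤ) ∣ (c a).2 - (c (a + e)).2)
  have hkpos : 0 < k := by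
    by_contra h
    have : (n : ℤ) * k ≤ 0 := mul_nonpos_of_nonneg_of_nonpos hn'.le (by omega)
    omega
  obtain ⟨k', rfl⟩ := Int.eq_ofNat_of_zero_le hkpos.le
  have hit : ∀ (q : ℕ) (x : Cell), x ∈ supp B → ((x.1 + q * m, x.2 + q * n) : Cell) ∈ supp B ∧
      d (x.1 + q * m, x.2 + q * n) = d x + q * l ∧
      d' (x.1 + q * m, x.2 + q * n) = d' x + q * l' := by
    intro q x hx
    induction q with
    | zero => simpa using hx
    | succ q ih =>
      obtain ⟨i1, i2, i3⟩ := ih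
      have j2 := hl _ i1
      have j3 := hl' _ i1
      have et : tauC m n (x.1 + q * m, x.2 + q * n) =
          (x.1 + ((q + 1 : ℕ) : ℤ) * m, x.2 + ((q + 1 : ℕ) : ℤ) * n) := by
        unfold tauC
        exact Prod.ext (by push_cast; ring) (by push_cast; ring)
      rw [et] at j2 j3
      refine ⟨?_, by rw [j2, i2]; push_cast; ring, by rw [j3, i3]; push_cast; ring⟩
      have := gap_zmul hB x.1 x.2 ((q + 1 : ℕ) : ℤ)
      show B _ _ ≠ 0
      dsimp only
      rw [this]; exact hx
  have hca : c a = ((c (a + e)).1 + k' * m, (c (a + e)).2 + k' * n) := by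
    refine Prod.ext ?_ ?_
    · dsimp only
      have : (n : ℤ) * (c a).1 = n * ((c (a + e)).1 + k' * m) := by
        linear_combination he2 + m * hk
      exact mul_left_cancel₀ hn'.ne' this
    · dsimp only
      linear_combination hk
  obtain ⟨-, i2, i3⟩ := hit k' _ (hcS (a + e))
  rw [← hca] at i2 i3
  have : (k' : ℤ) * l ≤ k' * l' := by linarith
  have := le_of_mul_le_mul_left this hkpos
  exact_mod_cast this

/-! ### The crystal operator -/

theorem sumIco (f : ℤ → ℕ) {a b c : ℤ} (h1 : a ≤ b) (h2 : b ≤ c) :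
    ∑ i ∈ Finset.Ico a c, f i = ∑ i ∈ Finset.Ico a b, f i + ∑ i ∈ Finset.Ico b c, f i := by
  rw [← Finset.Ico_union_Ico_eq_Ico h1 h2, Finset.sum_union (Finset.Ico_disjoint_Ico_consecutive a b c)]

theorem sumIoc (f : ℤ → ℕ) {a b c : ℤ} (h1 : a ≤ b) (h2 : b ≤ c) :
    ∑ i ∈ Finset.Ioc a c, f i = ∑ i ∈ Finset.Ioc a b, f i + ∑ i ∈ Finset.Ioc b c, f i := by
  rw [← Finset.Ioc_union_Ioc_eq_Ioc h1 h2, Finset.sum_union (Finset.Ioc_disjoint_Ioc_of_le le_rfl)]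

theorem sumIco_left (f : ℤ → ℕ) {a b : ℤ} (h : a < b) :
    ∑ i ∈ Finset.Ico a b, f i = f a + ∑ i ∈ Finset.Ioo a b, f i := by
  rw [← Finset.Ioo_insert_left h, Finset.sum_insert (by simp)]

theorem col_left {A : Mat} {j u : ℤ} (hu : ColSurvPlus A j u)
    (humin : ∀ u' : ℤ, ColSurvPlus A j u' → u ≤ u') (a : ℕ) :
    (∑ i ∈ Finset.Ico (u - a) u, A i j) ≤ ∑ i ∈ Finset.Ioc (u - a) u, A i (j + 1) := by
  induction a using Nat.strong_induction_on with
  | _ a ih =>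
    rcases Nat.eq_zero_or_pos a with h0 | h0
    · subst h0; simp
    have ih' : ∀ w, u - a < w → w ≤ u →
        (∑ i ∈ Finset.Ico w u, A i j) ≤ ∑ i ∈ Finset.Ioc w u, A i (j + 1) := by
      intro w h1 h2
      have := ih (u - w).toNat (by omega)
      rwa [show u - ((u - w).toNat : ℤ) = w by omega] at this
    by_contra hlt
    push Not at hlt
    have hvu : u - (a : ℤ) < u := by omega
    generalize u - (a : ℤ) = v at ih' hlt hvu
    have hpos : 0 < A v j := by
      rw [Nat.pos_iff_ne_zero]
      intro h
      have e1 := sumIco (fun i => A i j) (a := v) (b := v + 1) (c := u) (by omega) (by omega)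
      have e2 := sumIoc (fun i => A i (j + 1)) (a := v) (b := v + 1) (c := u) (by omega) (by omega)
      have e3 : ∑ i ∈ Finset.Ico v (v + 1), A i j = 0 := by
        rw [sumIco_left _ (by omega), h]
        rw [show Finset.Ioo v (v + 1) = ∅ by ext x; simp]; simp
      have := ih' (v + 1) (by omega) (by omega)
      omega
    have : ColSurvPlus A j v := by
      refine ⟨hpos, fun w hw => ?_⟩
      have e0 := sumIco_left (fun i => A i j) hw
      rcases le_or_gt w u with hwu | hwu
      · have e1 := sumIco (fun i => A i j) hw.le hwu
        have e2 := sumIoc (fun i => A i (j + 1)) hw.le hwu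
        have := ih' w hw hwu
        omega
      · have e1 := sumIco (fun i => A i j) hvu.le hwu.le
        have e2 := sumIoc (fun i => A i (j + 1)) hvu.le hwu.le
        have e3 := sumIco_left (fun i => A i j) hwu
        have e4 := hu.2 w hwu
        have e5 := hu.1
        omega
    have := humin v this
    omega

theorem ft_gap {m n : ℕ} (hn : 2 ≤ n) {A : Mat} (hA : IsGAP m n A) (u j : ℤ) :
    IsGAP m n (ftApply m n u j A) := by
  have hn' : (0 : ℤ) < n := by exact_mod_cast (by omega : 0 < n)
  constructor
  · intro x y
    have key : ∀ w : ℤ, (∃ k : ℤ, x + m = u + k * m ∧ y + n = w + k * n) ↔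
        ∃ k : ℤ, x = u + k * m ∧ y = w + k * n := by
      intro w
      constructor
      · rintro ⟨k, h1, h2⟩
        exact ⟨k - 1, by linear_combination h1, by linear_combination h2⟩
      · rintro ⟨k, h1, h2⟩
        exact ⟨k + 1, by linear_combination h1, by linear_combination h2⟩
    unfold ftApply
    simp only [key, hA.1]
  · intro y
    have hsub : {i : ℤ | ftApply m n u j A i y ≠ 0} ⊆ {i : ℤ | A i y ≠ 0} ∪
        {i : ℤ | ∃ k : ℤ, i = u + k * m ∧ y = j + 1 + k * n} := by
      intro i hi
      by_contra hc
      simp only [Set.mem_union, Set.mem_ofPred_eq, not_or, not_not] at hc hi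
      apply hi
      unfold ftApply
      rw [if_neg hc.2]
      split_ifs <;> omega
    refine ((hA.2 y).union (Set.Subsingleton.finite ?_)).subset hsub
    rintro a ⟨k, h1, h2⟩ b ⟨k', h1', h2'⟩
    have : k = k' := mul_right_cancel₀ hn'.ne' (by linarith : k * (n : ℤ) = k' * n)
    subst this
    omega

theorem ft_setup {m n : ℕ} (hm : 0 < m) (hn : 2 ≤ n) {A : Mat} (hA : IsGAP m n A) {j u : ℤ}
    (hu : ColSurvPlus A j u) (humin : ∀ u' : ℤ, ColSurvPlus A j u' → u ≤ u') :
    Setup (supp A) (supp (ftApply m n u j A)) (fun k => u + k * m) (fun k => j + k * n) := by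
  have hn' : (2 : ℤ) ≤ n := by exact_mod_cast hn
  have hm' : (0 : ℤ) < m := by exact_mod_cast hm
  have hne1 : ∀ k k' : ℤ, j + k * n ≠ j + 1 + k' * n := by
    intro k k' h
    have h1 : (k - k') * (n : ℤ) = 1 := by linear_combination h
    have := Int.le_of_dvd one_pos ⟨k - k', by linarith⟩ (a := (n : ℤ))
    omega
  have hshift : ∀ i y k : ℤ, A (i + k * m) (y + k * n) = A i y := fun i y k => gap_zmul hA i y k
  have hbase : ∀ i y k : ℤ, A i (y + k * n) = A (i - k * m) y := by
    intro i y k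
    rw [← hshift (i - k * m) y k, sub_add_cancel]
  refine ⟨?_, ?_, ?_, ?_, ?_, ?_, ?_⟩
  · intro k k' h
    try dsimp only
    constructor <;> nlinarith
  · intro k
    show A _ _ ≠ 0
    dsimp only
    rw [hshift]
    exact hu.1.ne'
  · intro k
    show ftApply m n u j A _ _ ≠ 0
    unfold ftApply
    dsimp only
    rw [if_neg, if_pos]
    · omega
    · exact ⟨k, rfl, by ring⟩
    · rintro ⟨k', -, h⟩
      exact hne1 k' k (by linarith)
  · intro c hc hc'
    have hc1 : A c.1 c.2 ≠ 0 := hc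
    have hc2 : ftApply m n u j A c.1 c.2 = 0 := not_not.1 hc'
    unfold ftApply at hc2
    split_ifs at hc2 with g1 g2
    · obtain ⟨k, e1, e2⟩ := g1
      exact ⟨k, Prod.ext e1 e2⟩
    · exact absurd hc2 hc1
  · intro c hc hc'
    have hc1 : A c.1 c.2 = 0 := not_not.1 hc'
    have hc2 : ftApply m n u j A c.1 c.2 ≠ 0 := hc
    unfold ftApply at hc2
    split_ifs at hc2 with g1 g2
    · omega
    · obtain ⟨k, e1, e2⟩ := g2
      exact ⟨k, Prod.ext e1 (by dsimp only; linarith)⟩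
    · exact absurd hc1 hc2
  · intro k i hi hiS
    try dsimp only at hi hiS ⊢
    have hiA : A i (j + k * n + 1) ≠ 0 := hiS
    rw [show j + k * (n : ℤ) + 1 = (j + 1) + k * n by ring, hbase] at hiA
    have hR := hu.2 (i - k * m) (by omega)
    have h1 : A (i - k * m) (j + 1) ≤ ∑ i ∈ Finset.Ioc u (i - k * m), A i (j + 1) :=
      Finset.single_le_sum (f := fun i => A i (j + 1)) (fun _ _ => Nat.zero_le _)
        (Finset.mem_Ioc.2 ⟨by omega, le_rfl⟩)
    by_cases hA1 : A u j - 1 = 0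
    · have hsum : ∑ i ∈ Finset.Ioo u (i - k * m), A i j ≠ 0 := by omega
      obtain ⟨i1, hi1, hv⟩ := Finset.exists_ne_zero_of_sum_ne_zero hsum
      rw [Finset.mem_Ioo] at hi1
      refine ⟨i1 + k * m, by omega, by omega, ?_⟩
      show ftApply m n u j A _ _ ≠ 0
      unfold ftApply
      dsimp only
      rw [hshift]
      split_ifs with g1
      · obtain ⟨k', e1, e2⟩ := g1
        have : k = k' := mul_right_cancel₀ (by omega : (n : ℤ) ≠ 0) (by linarith : k * (n : ℤ) = k' * n)
        subst this
        omega
      · omega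
      · exact hv
    · refine ⟨u + k * m, le_rfl, hi, ?_⟩
      show ftApply m n u j A _ _ ≠ 0
      unfold ftApply
      dsimp only
      rw [if_pos ⟨k, rfl, rfl⟩, hshift]
      exact hA1
  · intro k i hi hiS
    try dsimp only at hi hiS ⊢
    have hiA : A i (j + k * n) ≠ 0 := hiS
    rw [hbase] at hiA
    have hL := col_left hu humin (u - (i - k * m)).toNat
    rw [show u - ((u - (i - k * m)).toNat : ℤ) = i - k * m by omega] at hL
    have h1 : A (i - k * m) j ≤ ∑ i ∈ Finset.Ico (i - k * m) u, A i j :=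
      Finset.single_le_sum (f := fun i => A i j) (fun _ _ => Nat.zero_le _)
        (Finset.mem_Ico.2 ⟨le_rfl, by omega⟩)
    have hsum : ∑ i ∈ Finset.Ioc (i - k * m) u, A i (j + 1) ≠ 0 := by omega
    obtain ⟨i1, hi1, hv⟩ := Finset.exists_ne_zero_of_sum_ne_zero hsum
    rw [Finset.mem_Ioc] at hi1
    refine ⟨i1 + k * m, by omega, by omega, ?_⟩
    show A _ _ ≠ 0
    dsimp only
    rw [show j + k * (n : ℤ) + 1 = (j + 1) + k * n by ring, hshift]
    exact hv

theorem E1_succ {m n l : ℕ} {A : Mat} (hA : IsGAP m n A) {d : Cell → ℤ}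
    (hl : ∀ c ∈ supp A, d (tauC m n c) = d c + (l : ℤ)) (u j k : ℤ)
    (hp : ((u + k * m, j + k * n) : Cell) ∈ supp A) :
    E1 (supp A) (fun k => u + k * m) (fun k => j + k * n) d (k + 1) =
      E1 (supp A) (fun k => u + k * m) (fun k => j + k * n) d k + l := by
  have ht : ∀ i, tauC m n (i, j + k * n) = (i + m, j + (k + 1) * n) := by
    intro i
    exact Prod.ext rfl (by simp only [tauC]; ring)
  have hpv : d (u + (k + 1) * m, j + (k + 1) * n) = d (u + k * m, j + k * n) + l := by
    rw [← hl _ hp, ht]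
    congr 2; ring
  have hmem : ∀ i, ((i + m, j + (k + 1) * n) : Cell) ∈ supp A ↔ ((i, j + k * n) : Cell) ∈ supp A := by
    intro i
    show A _ _ ≠ 0 ↔ A _ _ ≠ 0
    dsimp only
    rw [← hA.1 i (j + k * n), show j + (k + 1) * (n : ℤ) = j + k * n + n by ring]
  have hQ : Q1 (supp A) (fun k => u + k * m) (fun k => j + k * n) d (k + 1) ↔
      Q1 (supp A) (fun k => u + k * m) (fun k => j + k * n) d k := by
    unfold Q1
    dsimp only
    have eU : u + (k + 1) * (m : ℤ) = u + k * m + m := by ring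
    rw [hpv]
    constructor
    · rintro ⟨i, h1, h2, h3⟩
      have e : i = (i - m) + m := by ring
      rw [e] at h2 h3
      have h2' := (hmem _).1 h2
      refine ⟨i - m, by omega, h2', ?_⟩
      have := hl _ h2'
      rw [ht] at this
      omega
    · rintro ⟨i, h1, h2, h3⟩
      refine ⟨i + m, by omega, (hmem _).2 h2, ?_⟩
      have := hl _ h2
      rw [ht] at this
      omega
  unfold E1
  simp only [hQ]
  try dsimp only
  rw [hpv]
  split_ifs <;> ring

/-- Let `n ≥ 2`, `A ∈ M̂_{m×n}` nonzero, and suppose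
`Ã := f̃^t_j A ≠ 0`, i.e. `Ã = A - Ê_{u,j} + Ê_{u,j+1}` for the selected row
`u` (the leftmost surviving `+`). Then: (1) every proper numbering `d` on `A`
transfers to a proper numbering `d⁻` on `Ã` agreeing with `d` on
`supp A ∩ supp Ã`, with `d⁻(u, j+1) = d(u, j)` if `u` is the minimal row index
`i` with `(i, j) ∈ z_s(d)` (`s = d(u, j)`) and `d⁻(u, j+1) = d(u, j) + 1`
otherwise; (2) conversely for proper numberings on `Ã` (with `t = d(u, j+1)`,
`d⁺(u, j) = t - 1` if `(u, j) ∈ z_{t-1}(d)` and `d⁺(u, j) = t` otherwise);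
in particular `A` and `Ã` have the same width. -/
theorem numbering_transfer_under_ft (m n : ℕ) (hm : 0 < m) (hn : 2 ≤ n)
    (A : Mat) (hA : IsGAP m n A) (hA0 : A ≠ 0) (j u : ℤ)
    (hu : ColSurvPlus A j u) (humin : ∀ u' : ℤ, ColSurvPlus A j u' → u ≤ u') :
    (∀ d : Cell → ℤ, IsProper A d →
      ∃ dm : Cell → ℤ, IsProper (ftApply m n u j A) dm ∧
        (∀ c ∈ supp A ∩ supp (ftApply m n u j A), dm c = d c) ∧
        ((∃ z : ℤ → Cell, ZigZagAt A d (d (u, j)) z ∧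
            ((u, j) : Cell) ∈ Set.range z ∧
            ∀ i : ℤ, ((i, j) : Cell) ∈ Set.range z → u ≤ i) →
          dm (u, j + 1) = d (u, j)) ∧
        ((¬ ∃ z : ℤ → Cell, ZigZagAt A d (d (u, j)) z ∧
            ((u, j) : Cell) ∈ Set.range z ∧
            ∀ i : ℤ, ((i, j) : Cell) ∈ Set.range z → u ≤ i) →
          dm (u, j + 1) = d (u, j) + 1)) ∧
    (∀ d : Cell → ℤ, IsProper (ftApply m n u j A) d →
      ∃ dp : Cell → ℤ, IsProper A dp ∧
        (∀ c ∈ supp A ∩ supp (ftApply m n u j A), dp c = d c) ∧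
        ((∃ z : ℤ → Cell, ZigZagAt (ftApply m n u j A) d (d (u, j + 1) - 1) z ∧
            ((u, j) : Cell) ∈ Set.range z) →
          dp (u, j) = d (u, j + 1) - 1) ∧
        ((¬ ∃ z : ℤ → Cell, ZigZagAt (ftApply m n u j A) d (d (u, j + 1) - 1) z ∧
            ((u, j) : Cell) ∈ Set.range z) →
          dp (u, j) = d (u, j + 1))) ∧
    ∀ lA lB : ℕ, HasWidth m n A lA → HasWidth m n (ftApply m n u j A) lB →
      lA = lB := by
  set B := ftApply m n u j A with hBdef
  have H : Setup (supp A) (supp B) (fun k => u + k * m) (fun k => j + k * n) :=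
    ft_setup hm hn hA hu humin
  have hBgap : IsGAP m n B := ft_gap hn hA u j
  have hn0 : 0 < n := by omega
  have hpS : ((u, j) : Cell) ∈ supp A := by simpa using H.hp 0
  have hqT : ((u, j + 1) : Cell) ∈ supp B := by simpa using H.hq 0
  refine ⟨?_, ?_, ?_⟩
  · intro d hd
    obtain ⟨dm, h1, h2, h3⟩ := part1 H hd
    have h30 := h3 0
    have hfin := level_finite hm hn0 hA hd (d (u, j))
    have hpL : ((u, j) : Cell) ∈ levelSet A d (d (u, j)) := ⟨hpS, rfl⟩
    have hnoNW : ∀ i, ((i, j) : Cell) ∈ levelSet A d (d (u, j)) →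
        ¬ ∃ r ∈ levelSet A d (d (u, j)), NW r (i, j) := by
      rintro i hi ⟨r, hr, hrn⟩
      have := hd.1 _ hi.1 r hr.1 hrn
      have e1 := hr.2
      have e2 := hi.2
      omega
    have hiff : (∃ z : ℤ → Cell, ZigZagAt A d (d (u, j)) z ∧
            ((u, j) : Cell) ∈ Set.range z ∧
            ∀ i : ℤ, ((i, j) : Cell) ∈ Set.range z → u ≤ i) ↔
        ¬ Q1 (supp A) (fun k => u + k * m) (fun k => j + k * n) d 0 := by
      simp only [Q1, zero_mul, add_zero]
      constructor
      · rintro ⟨z, hz, -, hmin⟩ ⟨i, hi, hiS, hiv⟩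
        have hiL : ((i, j) : Cell) ∈ levelSet A d (d (u, j)) := ⟨hiS, hiv⟩
        have := hmin i ((zz_range hfin hz.1 hz.2 _).2
          ⟨⟨_, hiL, le_refl _, le_refl _⟩, hnoNW i hiL⟩)
        omega
      · intro hQ
        obtain ⟨z, hz⟩ := zz_exists hfin ⟨_, hpL⟩
        refine ⟨z, hz, (zz_range hfin hz.1 hz.2 _).2
          ⟨⟨_, hpL, le_refl _, le_refl _⟩, hnoNW u hpL⟩, ?_⟩
        intro i hi
        obtain ⟨⟨r, hr, hr1, hr2⟩, -⟩ := (zz_range hfin hz.1 hz.2 _).1 hi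
        dsimp only at hr1 hr2
        by_contra hlt
        rcases lt_or_eq_of_le hr2 with h | h
        · exact hnoNW u hpL ⟨r, hr, by show r.1 < u; omega, h⟩
        · have hre : r = (r.1, j) := Prod.ext rfl h
          exact hQ ⟨r.1, by omega, hre ▸ hr.1, hre ▸ hr.2⟩
    refine ⟨dm, h1, h2, ?_, ?_⟩
    · intro h
      rw [E1, if_neg (hiff.1 h)] at h30
      simpa using h30
    · intro h
      rw [E1, if_pos (not_not.1 (fun h' => h (hiff.2 h')))] at h30
      simpa using h30
  · intro d hd
    obtain ⟨dp, h1, h2, h3⟩ := part2 H hd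
    have h30 := h3 0
    have hfin := level_finite hm hn0 hBgap hd (d (u, j + 1) - 1)
    have hiff : (∃ z : ℤ → Cell, ZigZagAt B d (d (u, j + 1) - 1) z ∧
            ((u, j) : Cell) ∈ Set.range z) ↔
        ¬ Q2 (supp B) (fun k => u + k * m) (fun k => j + k * n) d 0 := by
      constructor
      · rintro ⟨z, hz, hr⟩ hQ
        simp only [Q2, zero_mul, add_zero] at hQ
        obtain ⟨r, hrT, hrn, hrv⟩ := hQ
        exact ((zz_range hfin hz.1 hz.2 _).1 hr).2 ⟨r, ⟨hrT, hrv⟩, hrn⟩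
      · intro hQ
        obtain ⟨i, hi, hiT, hiv⟩ := notQ2 H hd hQ
        simp only [Q2, zero_mul, add_zero] at hQ hi hiT hiv
        have hiL : ((i, j) : Cell) ∈ levelSet B d (d (u, j + 1) - 1) := ⟨hiT, hiv⟩
        obtain ⟨z, hz⟩ := zz_exists hfin ⟨_, hiL⟩
        refine ⟨z, hz, (zz_range hfin hz.1 hz.2 _).2 ⟨⟨_, hiL, hi.le, le_refl _⟩, ?_⟩⟩
        rintro ⟨r, hr, hrn⟩
        exact hQ ⟨r, hr.1, hrn, hr.2⟩
    refine ⟨dp, h1, h2, ?_, ?_⟩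
    · intro h
      rw [E2, if_neg (hiff.1 h)] at h30
      simpa using h30
    · intro h
      rw [E2, if_pos (not_not.1 (fun h' => h (hiff.2 h')))] at h30
      simpa using h30
  · rintro lA lB ⟨d, hd, hl⟩ ⟨d', hd', hl'⟩
    obtain ⟨dm, h1, h2, h3⟩ := part1 H hd
    have hper : ∀ c ∈ supp B, dm (tauC m n c) = dm c + (lA : ℤ) := by
      intro c hc
      have hcT : tauC m n c ∈ supp B := by
        show B _ _ ≠ 0
        simp only [tauC]
        rw [hBgap.1]; exact hc
      by_cases hcS : c ∈ supp A
      · have hcS' : tauC m n c ∈ supp A := by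
          show A _ _ ≠ 0
          simp only [tauC]
          rw [hA.1]; exact hcS
        rw [h2 c ⟨hcS, hc⟩, h2 _ ⟨hcS', hcT⟩, hl c hcS]
      · obtain ⟨k, rfl⟩ := H.hTS c hc hcS
        have et : tauC m n (u + k * m, j + k * n + 1) =
            (u + (k + 1) * m, j + (k + 1) * n + 1) := by
          unfold tauC
          exact Prod.ext (by dsimp only; ring) (by dsimp only; ring)
        have hk := h3 k
        have hk1 := h3 (k + 1)
        try dsimp only at hk hk1 ⊢
        rw [et, hk, hk1]
        exact E1_succ hA hl u j k (H.hp k)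
    have hne : (supp B).Nonempty := ⟨_, hqT⟩
    exact le_antisymm (width_le hm hn0 hBgap hne h1 hper hd' hl')
      (width_le hm hn0 hBgap hne hd' hl' h1 hper)

end AffineRSK
end
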